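/- arXiv:1712.06110 — 7 statements merged into one kernel-verified Lean document; each statement's English description precedes it below -/
import Mathlib

section
/- Let X be a nonempty locally compact, σ-compact Hausdorff topological space, let w : X → ℂ and ψ : X → X be continuous, and let C_{w,ψ} : C(X) → C(X), f ↦ w·(f∘ψ), be the associated weighted composition operator. If C_{w,ψ} is topologically transitive on C(X), then: (i) w(x) ≠ 0 for every x ∈ X; (ii) ψ is injective; (iii) ψ(x) ≠ x for every x ∈ X; (iv) for every x ∈ X, the closure in X of the orbit {ψ^m(x) : m ∈ ℕ} is not compact. -/
/-- A self-map `T` of a topological space is topologically transitive if for every pair of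
nonempty open sets `U`, `V` there is `m ≥ 1` with `T^[m] '' U ∩ V ≠ ∅`. -/
def TopTransitive {E : Type*} [TopologicalSpace E] (T : E → E) : Prop :=
  ∀ U V : Set E, IsOpen U → IsOpen V → U.Nonempty → V.Nonempty →
    ∃ m : ℕ, 1 ≤ m ∧ ((T^[m] '' U) ∩ V).Nonempty

/-- The `m`-th iterate of a weighted composition operator is a weighted composition operator whose
weight is the product of `w` along the orbit. -/
theorem iterate_weightedComp_apply {X : Type*} [TopologicalSpace X]
    (w : C(X, ℂ)) (ψ : C(X, X)) (m : ℕ) (f : C(X, ℂ)) (x : X) :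
    ((fun f : C(X, ℂ) => w * f.comp ψ)^[m] f) x
      = (∏ i ∈ Finset.range m, w (ψ^[i] x)) * f (ψ^[m] x) := by
  induction m generalizing f with
  | zero => simp
  | succ m ih =>
    rw [Function.iterate_succ_apply, ih, Finset.prod_range_succ, Function.iterate_succ_apply']
    simp [mul_assoc]

/-- If the product of `w` along `m ≥ 1` steps of the orbit is bounded by one on a compact
invariant set, then all products of `w` along orbits in this set are uniformly bounded. -/
theorem exists_bound_prod_iterate {X : Type*} [TopologicalSpace X]
    (w : C(X, ℂ)) (ψ : C(X, X)) {K : Set X} (hK : IsCompact K) (hinv : Set.MapsTo ψ K K)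
    {m : ℕ} (hm : 1 ≤ m) (hle : ∀ x ∈ K, ‖∏ i ∈ Finset.range m, w (ψ^[i] x)‖ ≤ 1) :
    ∃ C : ℝ, 0 ≤ C ∧ ∀ n, ∀ x ∈ K, ‖∏ i ∈ Finset.range n, w (ψ^[i] x)‖ ≤ C := by
  have hb : ∀ r : ℕ, ∃ C : ℝ, ∀ x ∈ K, ‖∏ i ∈ Finset.range r, w (ψ^[i] x)‖ ≤ C := fun r =>
    hK.exists_bound_of_continuousOn <| Continuous.continuousOn <|
      continuous_finsetProd _ fun i _ => w.continuous.comp (ψ.continuous.iterate i)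
  choose c hc using hb
  refine ⟨∑ r ∈ Finset.range m, |c r|, Finset.sum_nonneg fun _ _ => abs_nonneg _, fun n => ?_⟩
  induction n using Nat.strong_induction_on with
  | _ n ih =>
    intro x hx
    rcases lt_or_ge n m with h | h
    · exact (hc n x hx).trans <| (le_abs_self _).trans <|
        Finset.single_le_sum (f := fun r => |c r|) (fun _ _ => abs_nonneg _)
          (Finset.mem_range.2 h)
    · obtain ⟨k, rfl⟩ := Nat.exists_eq_add_of_le h
      have hk := ih k (by omega) (ψ^[m] x) (hinv.iterate m hx)
      rw [Finset.prod_range_add, norm_mul]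
      simp only [← Function.iterate_add_apply, add_comm _ m] at hk ⊢
      exact (mul_le_of_le_one_left (norm_nonneg _) (hle x hx)).trans hk

/-- A weighted composition operator whose symbol has a nonempty compact invariant set is not
topologically transitive. -/
theorem not_topTransitive_of_isCompact_mapsTo {X : Type*} [TopologicalSpace X]
    (w : C(X, ℂ)) (ψ : C(X, X)) {K : Set X} (hK : IsCompact K) (hne : K.Nonempty)
    (hinv : Set.MapsTo ψ K K) :
    ¬ TopTransitive (fun f : C(X, ℂ) => w * f.comp ψ) := by
  intro htrans
  have hlt : ∀ c : ℝ, IsOpen {f : C(X, ℂ) | Set.MapsTo f K {z | ‖z‖ < c}} := fun c =>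
    ContinuousMap.isOpen_setOfPred_mapsTo hK (isOpen_lt continuous_norm continuous_const)
  have hgt : IsOpen {f : C(X, ℂ) | Set.MapsTo f K {z | 1 < ‖z‖}} :=
    ContinuousMap.isOpen_setOfPred_mapsTo hK (isOpen_lt continuous_const continuous_norm)
  have hgt_ne : {f : C(X, ℂ) | Set.MapsTo f K {z | 1 < ‖z‖}}.Nonempty :=
    ⟨ContinuousMap.const X 2, fun x _ => by simp⟩
  have hlt_ne : ∀ c : ℝ, 0 < c → {f : C(X, ℂ) | Set.MapsTo f K {z | ‖z‖ < c}}.Nonempty :=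
    fun c hc => ⟨0, fun x _ => by simpa using hc⟩
  obtain ⟨m, hm, _, ⟨f, hf, rfl⟩, hTf⟩ :=
    htrans _ _ hgt (hlt 1) hgt_ne (hlt_ne 1 one_pos)
  obtain ⟨C, hC, hbound⟩ := exists_bound_prod_iterate w ψ hK hinv hm fun x hx => by
    have h1 : 1 < ‖f (ψ^[m] x)‖ := hf (hinv.iterate m hx)
    have h2 := hTf hx
    rw [Set.mem_ofPred_eq, iterate_weightedComp_apply, norm_mul] at h2
    exact (le_mul_of_one_le_right (norm_nonneg _) h1.le).trans h2.le
  have hC' : 0 < C + 1 := by positivity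
  obtain ⟨n, -, _, ⟨g, hg, rfl⟩, hTg⟩ :=
    htrans _ _ (hlt (C + 1)⁻¹) hgt (hlt_ne _ (inv_pos.2 hC')) hgt_ne
  obtain ⟨x, hx⟩ := hne
  have h1 : ‖g (ψ^[n] x)‖ < (C + 1)⁻¹ := hg (hinv.iterate n hx)
  have h2 := hTg hx
  rw [Set.mem_ofPred_eq, iterate_weightedComp_apply, norm_mul] at h2
  have h3 := mul_le_mul (hbound n x hx) h1.le (norm_nonneg _) hC
  have h4 : C * (C + 1)⁻¹ ≤ 1 := by
    rw [← div_eq_mul_inv, div_le_one hC']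
    linarith
  linarith

/-- necessary conditions for topological transitivity of a weighted composition
operator `f ↦ w·(f ∘ ψ)` on `C(X, ℂ)` (compact-open topology), for `X` a nonempty locally
compact, σ-compact Hausdorff space. -/
theorem stmt0 {X : Type*} [TopologicalSpace X] [LocallyCompactSpace X]
    [SigmaCompactSpace X] [T2Space X] [Nonempty X]
    (w : C(X, ℂ)) (ψ : C(X, X))
    (htrans : TopTransitive (fun f : C(X, ℂ) => w * f.comp ψ)) :
    (∀ x : X, w x ≠ 0) ∧
    Function.Injective ψ ∧
    (∀ x : X, ψ x ≠ x) ∧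
    (∀ x : X, ¬ IsCompact (closure (Set.range fun m : ℕ => (⇑ψ)^[m] x))) := by
  have hw : ∀ x : X, w x ≠ 0 := by
    intro x hx
    obtain ⟨m, hm, _, ⟨f, -, rfl⟩, hf⟩ := htrans Set.univ {f | f x ≠ 0} isOpen_univ
      (isOpen_ne_fun (continuous_eval_const x) continuous_const)
      Set.univ_nonempty ⟨1, by simp⟩
    obtain ⟨k, rfl⟩ := Nat.exists_eq_add_of_le' hm
    simp [Function.iterate_succ_apply', hx] at hf
  refine ⟨hw, ?_, ?_, ?_⟩
  · intro x y hxy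
    by_contra hne
    have hsep : ∃ h : C(X, ℂ), w y * h x ≠ w x * h y := by
      obtain ⟨h, h0, h1, -⟩ := exists_continuous_zero_one_of_isCompact
        (isCompact_singleton (x := x)) (isClosed_singleton (x := y))
        (Set.disjoint_singleton.2 hne)
      have hx0 : h x = 0 := h0 rfl
      have hy1 : h y = 1 := h1 rfl
      exact ⟨⟨fun z => (h z : ℂ), by fun_prop⟩, by simpa [hx0, hy1] using (hw x).symm⟩
    obtain ⟨m, hm, _, ⟨f, -, rfl⟩, hf⟩ := htrans Set.univ {h | w y * h x ≠ w x * h y}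
      isOpen_univ
      (isOpen_ne_fun (continuous_const.mul (continuous_eval_const x))
        (continuous_const.mul (continuous_eval_const y)))
      Set.univ_nonempty hsep
    obtain ⟨k, rfl⟩ := Nat.exists_eq_add_of_le' hm
    refine hf ?_
    simp only [Function.iterate_succ_apply', ContinuousMap.mul_apply, ContinuousMap.comp_apply,
      hxy]
    ring
  · intro x hx
    exact not_topTransitive_of_isCompact_mapsTo w ψ (isCompact_singleton (x := x))
      (Set.singleton_nonempty x) (by simpa using hx) htrans
  · intro x hK
    refine not_topTransitive_of_isCompact_mapsTo w ψ hK
      (Set.range_nonempty _).closure (Set.MapsTo.closure ?_ ψ.continuous) htrans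
    rintro _ ⟨m, rfl⟩
    exact ⟨m + 1, Function.iterate_succ_apply' _ _ _⟩
end

section
/- Let X be a nonempty locally compact, σ-compact Hausdorff topological space, let w : X → ℂ and ψ : X → X be continuous, and assume |w(x)| ≤ 1 for all x ∈ X. If the weighted composition operator C_{w,ψ} : C(X) → C(X), f ↦ w·(f∘ψ), is topologically transitive on C(X), then ψ is run-away, i.e. for every compact set K ⊆ X there exists m ≥ 1 with ψ^m(K) ∩ K = ∅. -/
/-- A continuous self-map `ψ` of a topological space is run-away if for every compact set `K`
there is `m ≥ 1` with `ψ^[m](K) ∩ K = ∅`. -/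
def RunAway {X : Type*} [TopologicalSpace X] (ψ : X → X) : Prop :=
  ∀ K : Set X, IsCompact K → ∃ m : ℕ, 1 ≤ m ∧ (ψ^[m] '' K) ∩ K = ∅

/-- Iterating a weighted composition operator whose weight is bounded by one does not increase
values beyond those along the orbit. -/
theorem norm_iterate_weightedComp_le {X : Type*} [TopologicalSpace X] (w : C(X, ℂ)) (ψ : C(X, X))
    (hw : ∀ x : X, ‖w x‖ ≤ 1) (m : ℕ) (f : C(X, ℂ)) (x : X) :
    ‖((fun g : C(X, ℂ) => w * g.comp ψ)^[m] f) x‖ ≤ ‖f (ψ^[m] x)‖ := by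
  induction m generalizing x with
  | zero => simp
  | succ m ih =>
    rw [Function.iterate_succ_apply', Function.iterate_succ_apply]
    simp only [ContinuousMap.mul_apply, ContinuousMap.comp_apply, norm_mul]
    exact (mul_le_of_le_one_left (norm_nonneg _) (hw x)).trans (ih (ψ x))

/-- if `|w| ≤ 1` and the weighted composition operator `f ↦ w·(f ∘ ψ)` is
topologically transitive on `C(X, ℂ)`, then `ψ` is run-away. -/
theorem stmt1 {X : Type*} [TopologicalSpace X] [LocallyCompactSpace X]
    [SigmaCompactSpace X] [T2Space X] [Nonempty X]
    (w : C(X, ℂ)) (ψ : C(X, X))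
    (hw : ∀ x : X, ‖w x‖ ≤ 1)
    (htrans : TopTransitive (fun f : C(X, ℂ) => w * f.comp ψ)) :
    RunAway ⇑ψ := by
  intro K hK
  obtain ⟨m, hm, _, ⟨f, hf, rfl⟩, hg⟩ := htrans
    {f | Set.MapsTo f K {z : ℂ | ‖z‖ < 1}} {f | Set.MapsTo f K {z : ℂ | 1 < ‖z‖}}
    (ContinuousMap.isOpen_setOfPred_mapsTo hK (isOpen_lt continuous_norm continuous_const))
    (ContinuousMap.isOpen_setOfPred_mapsTo hK (isOpen_lt continuous_const continuous_norm))
    ⟨0, fun x _ => by simp⟩ ⟨ContinuousMap.const X 2, fun x _ => by simp⟩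
  refine ⟨m, hm, Set.eq_empty_iff_forall_notMem.2 ?_⟩
  rintro _ ⟨⟨x, hx, rfl⟩, hy⟩
  exact lt_asymm (hf hy) ((hg hx).trans_le (norm_iterate_weightedComp_le w ψ hw m f x))
end

section
/- Let X be a nonempty locally compact, σ-compact Hausdorff topological space and let w : X → ℂ and ψ : X → X be continuous. If the weighted composition operator C_{w,ψ} : C(X) → C(X), f ↦ w·(f∘ψ), is topologically weakly mixing on C(X), then ψ is run-away, i.e. for every compact set K ⊆ X there exists m ≥ 1 with ψ^m(K) ∩ K = ∅. -/
/-- A self-map `T` of a topological space is topologically weakly mixing if for every choice of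
nonempty open sets `U₁, U₂, V₁, V₂` there is `m ≥ 1` with `T^[m] '' Uⱼ ∩ Vⱼ ≠ ∅` for `j = 1, 2`. -/
def TopWeaklyMixing {E : Type*} [TopologicalSpace E] (T : E → E) : Prop :=
  ∀ U₁ U₂ V₁ V₂ : Set E, IsOpen U₁ → IsOpen U₂ → IsOpen V₁ → IsOpen V₂ →
    U₁.Nonempty → U₂.Nonempty → V₁.Nonempty → V₂.Nonempty →
    ∃ m : ℕ, 1 ≤ m ∧ ((T^[m] '' U₁) ∩ V₁).Nonempty ∧ ((T^[m] '' U₂) ∩ V₂).Nonempty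

theorem exists_iterate_weightedComp_apply {X : Type*} [TopologicalSpace X] (w : C(X, ℂ))
    (ψ : C(X, X)) (m : ℕ) (x : X) :
    ∃ c : ℂ, ∀ f : C(X, ℂ), ((fun g : C(X, ℂ) => w * g.comp ψ)^[m] f) x = c * f (ψ^[m] x) := by
  induction m generalizing x with
  | zero => exact ⟨1, fun f => by simp⟩
  | succ m ih =>
    obtain ⟨c, hc⟩ := ih (ψ x)
    refine ⟨w x * c, fun f => ?_⟩
    rw [Function.iterate_succ_apply', Function.iterate_succ_apply, mul_assoc, ← hc]
    rfl

/-- if the weighted composition operator `f ↦ w·(f ∘ ψ)` is topologically weakly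
mixing on `C(X, ℂ)`, then `ψ` is run-away. -/
theorem stmt2 {X : Type*} [TopologicalSpace X] [LocallyCompactSpace X]
    [SigmaCompactSpace X] [T2Space X] [Nonempty X]
    (w : C(X, ℂ)) (ψ : C(X, X))
    (hwm : TopWeaklyMixing (fun f : C(X, ℂ) => w * f.comp ψ)) :
    RunAway ⇑ψ := by
  intro K hK
  have small_open : IsOpen {f : C(X, ℂ) | Set.MapsTo f K {z | ‖z‖ < 1}} :=
    ContinuousMap.isOpen_setOfPred_mapsTo hK (isOpen_lt continuous_norm continuous_const)
  have large_open : IsOpen {f : C(X, ℂ) | Set.MapsTo f K {z | 1 < ‖z‖}} :=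
    ContinuousMap.isOpen_setOfPred_mapsTo hK (isOpen_lt continuous_const continuous_norm)
  have small_nonempty : {f : C(X, ℂ) | Set.MapsTo f K {z | ‖z‖ < 1}}.Nonempty :=
    ⟨ContinuousMap.const X 0, fun x _ => by simp⟩
  have large_nonempty : {f : C(X, ℂ) | Set.MapsTo f K {z | 1 < ‖z‖}}.Nonempty :=
    ⟨ContinuousMap.const X 2, fun x _ => by simp⟩
  obtain ⟨m, hm, ⟨_, ⟨f, hf, rfl⟩, hTf⟩, ⟨_, ⟨g, hg, rfl⟩, hTg⟩⟩ :=
    hwm _ _ _ _ small_open large_open large_open small_open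
      small_nonempty large_nonempty large_nonempty small_nonempty
  refine ⟨m, hm, Set.eq_empty_iff_forall_notMem.2 ?_⟩
  rintro _ ⟨⟨x, hx, rfl⟩, hψx⟩
  obtain ⟨c, hc⟩ := exists_iterate_weightedComp_apply w ψ m x
  have hf' : ‖f (ψ^[m] x)‖ < 1 := hf hψx
  have hg' : 1 < ‖g (ψ^[m] x)‖ := hg hψx
  have hTf' : 1 < ‖c‖ * ‖f (ψ^[m] x)‖ := by
    rw [← norm_mul, ← hc]
    exact hTf hx
  have hTg' : ‖c‖ * ‖g (ψ^[m] x)‖ < 1 := by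
    rw [← norm_mul, ← hc]
    exact hTg hx
  nlinarith [norm_nonneg c]
end

section
/- Let Ω be a locally compact, σ-compact, non-compact Hausdorff space, let X ⊆ Ω be a nonempty open set, let w : X → ℂ be continuous, and let ψ : X → X be continuous and open. For the weighted composition operator C_{w,ψ} : C(X) → C(X), f ↦ w·(f∘ψ), the following are equivalent: (i) C_{w,ψ} is topologically weakly mixing on C(X); (ii) C_{w,ψ} is topologically transitive on C(X); (iii) w has no zeros, ψ is injective, and ψ is run-away. -/
section WeightedComposition

open Set Function

variable {Y : Type*} [TopologicalSpace Y]

/-- The weighted composition operator `f ↦ w·(f∘ψ)`. -/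
noncomputable abbrev weightedComp (w : C(Y, ℂ)) (ψ : C(Y, Y)) : C(Y, ℂ) → C(Y, ℂ) :=
  fun f => w * f.comp ψ

/-- The weight of the `m`-th iterate of a weighted composition operator. -/
noncomputable def iterWeight (w : C(Y, ℂ)) (ψ : C(Y, Y)) (m : ℕ) (x : Y) : ℂ :=
  ∏ j ∈ Finset.range m, w (ψ^[j] x)

variable {w : C(Y, ℂ)} {ψ : C(Y, Y)}

theorem iterWeight_add (m n : ℕ) (x : Y) :
    iterWeight w ψ (m + n) x = iterWeight w ψ m x * iterWeight w ψ n (ψ^[m] x) := by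
  simp only [iterWeight, Finset.prod_range_add, ← iterate_add_apply, Nat.add_comm]

theorem continuous_iterWeight (m : ℕ) : Continuous (iterWeight w ψ m) :=
  continuous_finsetProd _ fun j _ => w.continuous.comp (ψ.continuous.iterate j)

theorem iterWeight_ne_zero (hw : ∀ x, w x ≠ 0) (m : ℕ) (x : Y) : iterWeight w ψ m x ≠ 0 :=
  Finset.prod_ne_zero_iff.2 fun _ _ => hw _

theorem iterate_weightedComp_apply_s4 (m : ℕ) (f : C(Y, ℂ)) (x : Y) :
    ((weightedComp w ψ)^[m] f) x = iterWeight w ψ m x * f (ψ^[m] x) := by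
  induction m generalizing f with
  | zero => simp [iterWeight]
  | succ m ih =>
    rw [iterate_succ_apply, ih, iterWeight_add, iterate_succ_apply']
    simp [iterWeight, mul_assoc]

theorem IsCompact.exists_norm_le_of_continuous {F : ℕ → Y → ℂ} (hF : ∀ j, Continuous (F j))
    {K : Set Y} (hK : IsCompact K) (N : ℕ) : ∃ C, ∀ j ≤ N, ∀ x ∈ K, ‖F j x‖ ≤ C := by
  obtain ⟨C, hC⟩ := hK.exists_bound_of_continuousOn
    (f := fun x => ∑ j ∈ Finset.range (N + 1), ‖F j x‖)
    (continuous_finsetSum _ fun j _ => (hF j).norm).continuousOn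
  refine ⟨C, fun j hj x hx => le_trans ?_ ((le_abs_self _).trans (hC x hx))⟩
  exact Finset.single_le_sum (f := fun j => ‖F j x‖) (fun _ _ => norm_nonneg _)
    (Finset.mem_range.2 (by omega))

theorem ContinuousMap.exists_isCompact_eqOn_mem {U : Set C(Y, ℂ)} (hU : IsOpen U) {f : C(Y, ℂ)}
    (hf : f ∈ U) : ∃ K, IsCompact K ∧ ∀ g : C(Y, ℂ), EqOn g f K → g ∈ U := by
  obtain ⟨S, hSfin, hS, hSU⟩ := ContinuousMap.mem_nhds_iff.1 (hU.mem_nhds hf)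
  refine ⟨⋃ p ∈ S, p.1, hSfin.isCompact_biUnion fun p hp => (hS p.1 p.2 hp).1, fun g hg => ?_⟩
  refine hSU fun K V hKV => (hS K V hKV).2.2.congr fun x hx => (hg ?_).symm
  exact mem_iUnion₂.2 ⟨(K, V), hKV, hx⟩

theorem TopTransitive.exists_iterate_mem {E : Type*} [TopologicalSpace E] {T : E → E}
    (hT : TopTransitive T) {U V : Set E} (hU : IsOpen U) (hV : IsOpen V) {u v : E} (hu : u ∈ U)
    (hv : v ∈ V) : ∃ m, 1 ≤ m ∧ ∃ f ∈ U, T^[m] f ∈ V := by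
  obtain ⟨m, hm, _, ⟨f, hf, rfl⟩, hfV⟩ := hT U V hU hV ⟨u, hu⟩ ⟨v, hv⟩
  exact ⟨m, hm, f, hf, hfV⟩

theorem TopWeaklyMixing.topTransitive {E : Type*} [TopologicalSpace E] {T : E → E}
    (hT : TopWeaklyMixing T) : TopTransitive T := fun U V hU hV hU' hV' =>
  let ⟨m, hm, h, _⟩ := hT U U V V hU hU hV hV hU' hU' hV' hV'
  ⟨m, hm, h⟩

theorem TopTransitive.weight_ne_zero (hT : TopTransitive (weightedComp w ψ)) (x : Y) :
    w x ≠ 0 := by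
  intro hx
  obtain ⟨m, hm, f, -, hf⟩ := hT.exists_iterate_mem (U := univ) (V := {h | h x ≠ 0}) isOpen_univ
    (isOpen_ne_fun (continuous_eval_const x) continuous_const)
    (mem_univ 0) (v := 1) (by simp)
  obtain ⟨k, rfl⟩ := Nat.exists_eq_add_of_le hm
  apply hf
  rw [iterate_weightedComp_apply_s4, iterWeight_add]
  simp [iterWeight, hx]

theorem TopTransitive.injective_symbol [T2Space Y] [LocallyCompactSpace Y]
    (hT : TopTransitive (weightedComp w ψ)) : Injective ψ := by
  intro x y hxy
  by_contra hne
  obtain ⟨g, hg0, hg1, -⟩ := exists_continuous_zero_one_of_isCompact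
    (isCompact_singleton (x := x)) (isClosed_singleton (x := y)) (by simpa using hne)
  replace hg0 : g x = 0 := hg0 rfl
  replace hg1 : g y = 1 := hg1 rfl
  obtain ⟨m, hm, f, -, hf⟩ := hT.exists_iterate_mem (U := univ)
    (V := {h | h x * w y ≠ h y * w x}) isOpen_univ
    (isOpen_ne_fun ((continuous_eval_const x).mul_const _)
      ((continuous_eval_const y).mul_const _))
    (mem_univ 0) (v := ⟨fun z => (g z : ℂ), by fun_prop⟩)
    (by simpa [hg0, hg1] using (hT.weight_ne_zero x).symm)
  obtain ⟨k, rfl⟩ := Nat.exists_eq_add_of_le' hm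
  apply hf
  rw [iterate_succ_apply']
  simp only [ContinuousMap.mul_apply, ContinuousMap.comp_apply, hxy]
  ring

theorem TopTransitive.not_mapsTo_compact (hT : TopTransitive (weightedComp w ψ)) {Z : Set Y}
    (hZ : IsCompact Z) (hne : Z.Nonempty) : ¬ MapsTo ψ Z Z := by
  intro hψ
  by_cases hbig : ∃ z ∈ Z, ∀ n, 1 ≤ ‖iterWeight w ψ n z‖
  · obtain ⟨z, hz, hn⟩ := hbig
    obtain ⟨m, -, f, hf, hTf⟩ := hT.exists_iterate_mem
      (ContinuousMap.isOpen_setOfPred_mapsTo hZ (isOpen_lt continuous_const continuous_norm))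
      (ContinuousMap.isOpen_setOfPred_mapsTo hZ (isOpen_lt continuous_norm continuous_const))
      (u := ContinuousMap.const Y 2) (v := 0)
      (show MapsTo _ Z {c : ℂ | 1 < ‖c‖} from fun _ _ => by simp)
      (show MapsTo _ Z {c : ℂ | ‖c‖ < 1} from fun _ _ => by simp)
    have h1 : 1 < ‖f (ψ^[m] z)‖ := hf (hψ.iterate m hz)
    have h2 : ‖((weightedComp w ψ)^[m] f) z‖ < 1 := hTf hz
    rw [iterate_weightedComp_apply_s4, norm_mul] at h2
    nlinarith [hn m]
  · push Not at hbig
    obtain ⟨t, ht⟩ := hZ.elim_finite_subcover (fun n => {z | ‖iterWeight w ψ n z‖ < 1})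
      (fun n => isOpen_lt (continuous_iterWeight n).norm continuous_const)
      fun z hz => mem_iUnion.2 (hbig z hz)
    obtain ⟨C, hC⟩ := hZ.exists_norm_le_of_continuous (continuous_iterWeight (w := w) (ψ := ψ))
      (t.sup id)
    have hbound : ∀ m, ∀ z ∈ Z, ‖iterWeight w ψ m z‖ ≤ C := by
      intro m
      induction m using Nat.strong_induction_on with
      | _ m ih =>
        intro z hz
        obtain ⟨n, hn, hlt⟩ := mem_iUnion₂.1 (ht hz)
        replace hlt : ‖iterWeight w ψ n z‖ < 1 := hlt
        have hnN : n ≤ t.sup id := Finset.le_sup (f := id) hn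
        rcases le_total m n with hmn | hnm
        · exact hC m (hmn.trans hnN) z hz
        · have hn0 : n ≠ 0 := by
            rintro rfl
            simp [iterWeight] at hlt
          have := ih (m - n) (by omega) _ (hψ.iterate n hz)
          rw [← Nat.add_sub_cancel' hnm, iterWeight_add, norm_mul]
          exact (mul_le_of_le_one_left (norm_nonneg _) hlt.le).trans this
    obtain ⟨z, hz⟩ := hne
    obtain ⟨m, -, f, hf, hTf⟩ := hT.exists_iterate_mem
      (ContinuousMap.isOpen_setOfPred_mapsTo hZ (isOpen_lt continuous_norm continuous_const))
      (ContinuousMap.isOpen_setOfPred_mapsTo hZ (isOpen_lt continuous_const continuous_norm))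
      (u := 0) (v := ContinuousMap.const Y ((|C| + 1 : ℝ) : ℂ))
      (show MapsTo _ Z {c : ℂ | ‖c‖ < 1} from fun _ _ => by simp)
      (show MapsTo _ Z {c : ℂ | C < ‖c‖} from fun _ _ => by
        simp only [ContinuousMap.const_apply, mem_ofPred_eq, Complex.norm_real, Real.norm_eq_abs]
        linarith [le_abs_self C, le_abs_self (|C| + 1)])
    have h1 : ‖f (ψ^[m] z)‖ < 1 := hf (hψ.iterate m hz)
    have h2 : C < ‖((weightedComp w ψ)^[m] f) z‖ := hTf hz
    rw [iterate_weightedComp_apply_s4, norm_mul] at h2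
    nlinarith [hbound m z hz, norm_nonneg (iterWeight w ψ m z)]

theorem TopTransitive.exists_exit_time [T2Space Y] (hT : TopTransitive (weightedComp w ψ))
    {L : Set Y} (hL : IsCompact L) : ∃ N, ∀ x ∈ L, ∃ j ≤ N, ψ^[j] x ∉ L := by
  by_contra! hstay
  have hcl : ∀ n, IsClosed {x | ∀ j ≤ n, ψ^[j] x ∈ L} := fun n => by
    simp only [ofPred_forall]
    exact isClosed_iInter fun j => isClosed_iInter fun _ =>
      hL.isClosed.preimage (ψ.continuous.iterate j)
  have hsub : ∀ n, {x | ∀ j ≤ n, ψ^[j] x ∈ L} ⊆ L := fun n x hx => hx 0 (Nat.zero_le n)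
  have hne := IsCompact.nonempty_iInter_of_sequence_nonempty_isCompact_isClosed
    (fun n => {x | ∀ j ≤ n, ψ^[j] x ∈ L})
    (fun n x hx j hj => hx j (hj.trans n.le_succ)) (fun n => (hstay n).imp fun _ hx => hx.2)
    (hL.of_isClosed_subset (hcl 0) (hsub 0)) hcl
  refine hT.not_mapsTo_compact (hL.of_isClosed_subset (isClosed_iInter hcl)
    ((iInter_subset _ 0).trans (hsub 0))) hne fun x hx => mem_iInter.2 fun n j hj => ?_
  have hmem : ∀ i ≤ n + 1, ψ^[i] x ∈ L := mem_iInter.1 hx (n + 1)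
  exact hmem (j + 1) (Nat.succ_le_succ hj)

theorem TopTransitive.runAway [T2Space Y] [LocallyCompactSpace Y]
    (hT : TopTransitive (weightedComp w ψ)) : RunAway ψ := by
  intro K hK
  by_contra! hmeet
  obtain ⟨L, hL, hKL⟩ := exists_compact_superset hK
  obtain ⟨N, hN⟩ := hT.exists_exit_time hL
  have hw := iterWeight_ne_zero (ψ := ψ) hT.weight_ne_zero
  obtain ⟨C, hC⟩ := hK.exists_norm_le_of_continuous
    (continuous_iterWeight (w := w) (ψ := ψ)) N
  obtain ⟨D, hD⟩ := hK.exists_norm_le_of_continuous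
    (fun m => (continuous_iterWeight (w := w) (ψ := ψ) m).inv₀ (hw m)) N
  have hK₁ : IsCompact (⋃ j ∈ Iic N, ψ^[j] '' K) :=
    (finite_Iic N).isCompact_biUnion fun j _ => hK.image (ψ.continuous.iterate j)
  set K₁ := ⋃ j ∈ Iic N, ψ^[j] '' K
  have hmem : ∀ j ≤ N, ∀ x ∈ K, ψ^[j] x ∈ K₁ := fun j hj x hx =>
    mem_iUnion₂.2 ⟨j, hj, mem_image_of_mem _ hx⟩
  obtain ⟨g, hg0, hg1, -⟩ := exists_continuous_zero_one_of_isCompact hK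
    isOpen_interior.isClosed_compl (disjoint_compl_right_iff_subset.2 hKL)
  set R := 8 * |C| * |D| with hR
  have hR0 : 0 ≤ R := by positivity
  obtain ⟨m, hm, f, ⟨hf1, hf2⟩, hTf⟩ := hT.exists_iterate_mem
    ((ContinuousMap.isOpen_setOfPred_mapsTo hK (isOpen_lt continuous_norm continuous_const)).inter
      (ContinuousMap.isOpen_setOfPred_mapsTo (hK₁.diff isOpen_interior)
        (isOpen_lt continuous_const continuous_norm)))
    (ContinuousMap.isOpen_setOfPred_mapsTo hK₁
      ((isOpen_lt continuous_const continuous_norm).inter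
        (isOpen_lt continuous_norm continuous_const)))
    (u := ⟨fun z => ((1 + R * g z : ℝ) : ℂ), by fun_prop⟩) (v := 1)
    ⟨show MapsTo _ K {c : ℂ | ‖c‖ < 2} from fun x hx => by
        simp [hg0 hx],
      show MapsTo _ (K₁ \ interior L) {c : ℂ | R < ‖c‖} from fun x hx => by
        simp only [ContinuousMap.coe_mk, mem_ofPred_eq, Complex.norm_real, Real.norm_eq_abs,
          hg1 hx.2, Pi.one_apply]
        linarith [le_abs_self (1 + R * 1)]⟩
    (show MapsTo _ K₁ ({c : ℂ | 1 / 2 < ‖c‖} ∩ {c : ℂ | ‖c‖ < 2}) from fun x _ => by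
      constructor <;> norm_num)
  obtain ⟨y, ⟨x, hx, rfl⟩, hy⟩ := hmeet m hm
  obtain ⟨j, hj, hout⟩ := hN _ (interior_subset (hKL hy))
  have hxT : 1 / 2 < ‖((weightedComp w ψ)^[m] f) x‖ := (hTf (hmem 0 (Nat.zero_le N) x hx)).1
  have hjT : ‖((weightedComp w ψ)^[m] f) (ψ^[j] x)‖ < 2 := (hTf (hmem j hj x hx)).2
  have hfy : ‖f (ψ^[m] x)‖ < 2 := hf1 hy
  have hfj : R < ‖f (ψ^[j] (ψ^[m] x))‖ :=
    hf2 ⟨hmem j hj _ hy, fun h => hout (interior_subset h)⟩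
  have key : ((weightedComp w ψ)^[m] f) (ψ^[j] x) * iterWeight w ψ j x * f (ψ^[m] x) =
      ((weightedComp w ψ)^[m] f) x * iterWeight w ψ j (ψ^[m] x) * f (ψ^[j] (ψ^[m] x)) := by
    have hcoc := (iterWeight_add (w := w) (ψ := ψ) m j x).symm
    rw [Nat.add_comm, iterWeight_add] at hcoc
    rw [iterate_weightedComp_apply_s4, iterate_weightedComp_apply_s4, ← iterate_add_apply,
      ← iterate_add_apply, Nat.add_comm m j]
    linear_combination (-f (ψ^[j + m] x) * f (ψ^[m] x)) * hcoc
  replace key := congrArg norm key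
  simp only [norm_mul] at key
  have hCx := (hC j hj x hx).trans (le_abs_self C)
  have hDy := (hD j hj _ hy).trans (le_abs_self D)
  have hpos : 0 < ‖iterWeight w ψ j (ψ^[m] x)‖ := norm_pos_iff.2 (hw _ _)
  rw [Pi.inv_apply, norm_inv, inv_le_iff_one_le_mul₀ hpos] at hDy
  have hle : ‖((weightedComp w ψ)^[m] f) (ψ^[j] x)‖ * ‖iterWeight w ψ j x‖ * ‖f (ψ^[m] x)‖ ≤
      2 * |C| * 2 := by gcongr
  have hlt : 1 / 2 * ‖iterWeight w ψ j (ψ^[m] x)‖ * R <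
      ‖((weightedComp w ψ)^[m] f) x‖ * ‖iterWeight w ψ j (ψ^[m] x)‖ *
        ‖f (ψ^[j] (ψ^[m] x))‖ := by
    gcongr
  nlinarith [abs_nonneg C]

/-- Data on two disjoint compact sets, the second an injective image, extend to a continuous
function. -/
theorem exists_continuousMap_eqOn_of_disjoint_image [T2Space Y] [LocallyCompactSpace Y]
    {K : Set Y} (hK : IsCompact K) {φ : C(Y, Y)} (hφ : Injective φ) (hd : φ '' K ∩ K = ∅)
    (f g : C(Y, ℂ)) : ∃ u : C(Y, ℂ), (∀ x ∈ K, u x = f x) ∧ ∀ x ∈ K, u (φ x) = g x := by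
  have : CompactSpace K := isCompact_iff_compactSpace.1 hK
  have hne : ∀ a b : K, φ a ≠ b := fun a b h =>
    (eq_empty_iff_forall_notMem.1 hd) b ⟨⟨a, a.2, h⟩, b.2⟩
  let e : K ⊕ K → OnePoint Y := Sum.elim (fun x => ((x : Y) : OnePoint Y))
    fun x => ((φ x : Y) : OnePoint Y)
  have he : Topology.IsClosedEmbedding e := by
    refine Continuous.isClosedEmbedding ?_ ?_
    · exact (OnePoint.continuous_coe.comp continuous_subtype_val).sumElim
        (OnePoint.continuous_coe.comp (φ.continuous.comp continuous_subtype_val))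
    · refine Injective.sumElim (OnePoint.coe_injective.comp Subtype.val_injective)
        (OnePoint.coe_injective.comp (hφ.comp Subtype.val_injective)) fun a b h => ?_
      exact hne b a (OnePoint.coe_injective h).symm
  obtain ⟨u, hu⟩ := ContinuousMap.exists_extension' he
    ⟨Sum.elim (fun x : K => f x) fun x : K => g x,
      (f.continuous.comp continuous_subtype_val).sumElim
        (g.continuous.comp continuous_subtype_val)⟩
  exact ⟨u.comp ⟨_, OnePoint.continuous_coe⟩, fun x hx => congrFun hu (Sum.inl ⟨x, hx⟩),
    fun x hx => congrFun hu (Sum.inr ⟨x, hx⟩)⟩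

theorem topWeaklyMixing_weightedComp [T2Space Y] [LocallyCompactSpace Y] (hw : ∀ x, w x ≠ 0)
    (hψ : Injective ψ) (hrun : RunAway ψ) : TopWeaklyMixing (weightedComp w ψ) := by
  rintro U₁ U₂ V₁ V₂ hU₁ hU₂ hV₁ hV₂ ⟨f₁, hf₁⟩ ⟨f₂, hf₂⟩ ⟨g₁, hg₁⟩ ⟨g₂, hg₂⟩
  obtain ⟨A₁, hA₁, hAU₁⟩ := ContinuousMap.exists_isCompact_eqOn_mem hU₁ hf₁
  obtain ⟨A₂, hA₂, hAU₂⟩ := ContinuousMap.exists_isCompact_eqOn_mem hU₂ hf₂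
  obtain ⟨B₁, hB₁, hBV₁⟩ := ContinuousMap.exists_isCompact_eqOn_mem hV₁ hg₁
  obtain ⟨B₂, hB₂, hBV₂⟩ := ContinuousMap.exists_isCompact_eqOn_mem hV₂ hg₂
  have hK := (hA₁.union hA₂).union (hB₁.union hB₂)
  obtain ⟨m, hm, hd⟩ := hrun _ hK
  have hext : ∀ f g : C(Y, ℂ), ∃ u : C(Y, ℂ), (∀ x ∈ A₁ ∪ A₂ ∪ (B₁ ∪ B₂), u x = f x) ∧
      ∀ x ∈ A₁ ∪ A₂ ∪ (B₁ ∪ B₂), ((weightedComp w ψ)^[m] u) x = g x := fun f g => by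
    have hw' := iterWeight_ne_zero (ψ := ψ) hw m
    obtain ⟨u, hu, hu'⟩ := exists_continuousMap_eqOn_of_disjoint_image hK
      (φ := ⟨ψ^[m], ψ.continuous.iterate m⟩) (hψ.iterate m) hd f
      ⟨fun x => g x / iterWeight w ψ m x, g.continuous.div (continuous_iterWeight m) hw'⟩
    refine ⟨u, hu, fun x hx => ?_⟩
    rw [iterate_weightedComp_apply_s4]
    exact (congrArg _ (hu' x hx)).trans (mul_div_cancel₀ _ (hw' x))
  obtain ⟨u₁, hu₁, hu₁'⟩ := hext f₁ g₁
  obtain ⟨u₂, hu₂, hu₂'⟩ := hext f₂ g₂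
  exact ⟨m, hm,
    ⟨_, mem_image_of_mem _ (hAU₁ u₁ fun x hx => hu₁ x (.inl (.inl hx))),
      hBV₁ _ fun x hx => hu₁' x (.inr (.inl hx))⟩,
    ⟨_, mem_image_of_mem _ (hAU₂ u₂ fun x hx => hu₂ x (.inl (.inr hx))),
      hBV₂ _ fun x hx => hu₂' x (.inr (.inr hx))⟩⟩

end WeightedComposition

/-- for `Ω` a locally compact, σ-compact, non-compact Hausdorff space, `X ⊆ Ω`
open and nonempty, `w : X → ℂ` continuous and `ψ : X → X` continuous and open, the weighted
composition operator `f ↦ w·(f∘ψ)` on `C(X, ℂ)` is weakly mixing iff it is transitive iff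
`w` has no zeros, `ψ` is injective and run-away. -/
theorem stmt4 {Ω : Type*} [TopologicalSpace Ω] [LocallyCompactSpace Ω]
    [SigmaCompactSpace Ω] [NoncompactSpace Ω] [T2Space Ω]
    (X : Set Ω) (hXopen : IsOpen X) (hXne : X.Nonempty)
    (w : C(↥X, ℂ)) (ψ : C(↥X, ↥X)) (hψopen : IsOpenMap ψ) :
    (TopWeaklyMixing (fun f : C(↥X, ℂ) => w * f.comp ψ) ↔
      TopTransitive (fun f : C(↥X, ℂ) => w * f.comp ψ)) ∧
    (TopTransitive (fun f : C(↥X, ℂ) => w * f.comp ψ) ↔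
      ((∀ x : ↥X, w x ≠ 0) ∧ Function.Injective ψ ∧ RunAway ⇑ψ)) := by
  have : LocallyCompactSpace X := hXopen.locallyCompactSpace
  have hsuff := fun h : (∀ x : ↥X, w x ≠ 0) ∧ Function.Injective ψ ∧ RunAway ⇑ψ =>
    topWeaklyMixing_weightedComp h.1 h.2.1 h.2.2
  have hnec := fun h : TopTransitive (weightedComp w ψ) =>
    And.intro h.weight_ne_zero (And.intro h.injective_symbol h.runAway)
  exact ⟨⟨fun h => h.topTransitive, fun h => hsuff (hnec h)⟩,
    ⟨hnec, fun h => (hsuff h).topTransitive⟩⟩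
end

section
/- Let Ω be a locally compact, σ-compact, non-compact Hausdorff space, let X ⊆ Ω be a nonempty open set, let w : X → ℂ be continuous, and let ψ : X → X be continuous and open. For the weighted composition operator C_{w,ψ} : C(X) → C(X), f ↦ w·(f∘ψ), the following are equivalent: (i) C_{w,ψ} is topologically mixing on C(X); (ii) w has no zeros, ψ is injective, and ψ is strong run-away. -/
/-- Topological mixing. -/
def TopMixing {E : Type*} [TopologicalSpace E] (T : E → E) : Prop :=
  ∀ U V : Set E, IsOpen U → IsOpen V → U.Nonempty → V.Nonempty →
    ∃ M : ℕ, ∀ m : ℕ, M ≤ m → ((T^[m] '' U) ∩ V).Nonempty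

/-- The strong run-away property. -/
def StrongRunAway {X : Type*} [TopologicalSpace X] (ψ : X → X) : Prop :=
  ∀ K : Set X, IsCompact K → ∃ M : ℕ, ∀ m : ℕ, M ≤ m → (ψ^[m] '' K) ∩ K = ∅

section WeightedComposition

open Function

variable {X : Type*} [TopologicalSpace X]

lemma iterate_mul_comp_apply (w : C(X, ℂ)) (ψ : C(X, X)) (m : ℕ) (f : C(X, ℂ)) (x : X) :
    ((fun f : C(X, ℂ) => w * f.comp ψ)^[m] f) x =
      (∏ i ∈ Finset.range m, w (ψ^[i] x)) * f (ψ^[m] x) := by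
  induction m generalizing f with
  | zero => simp
  | succ m ih =>
    rw [iterate_succ_apply, ih, Finset.prod_range_succ, iterate_succ_apply']
    simp [mul_assoc]

/-- A neighbourhood in the compact-open topology constrains functions only on a compact set. -/
lemma exists_isCompact_forall_eqOn_mem {U : Set C(X, ℂ)} (hU : IsOpen U) {f : C(X, ℂ)}
    (hf : f ∈ U) : ∃ K : Set X, IsCompact K ∧ ∀ g : C(X, ℂ), Set.EqOn g f K → g ∈ U := by
  obtain ⟨⟨K, V⟩, ⟨hK, hV⟩, hKV⟩ :=
    (nhds_basis_uniformity'
      ContinuousMap.hasBasis_compactConvergenceUniformity).mem_iff.1 (hU.mem_nhds hf)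
  refine ⟨K, hK, fun g hg => hKV fun x hx => ?_⟩
  rw [hg hx]
  exact refl_mem_uniformity hV

/-- Continuous functions prescribed on a compact set and, through a continuous injection `φ`, on a
disjoint image of it, extend to the whole locally compact Hausdorff space. -/
lemma exists_eqOn_comp_eqOn [LocallyCompactSpace X] [T2Space X] {K : Set X} (hK : IsCompact K)
    {φ : X → X} (hφ : Continuous φ) (hinj : Injective φ) (hdisj : φ '' K ∩ K = ∅)
    (f g : C(X, ℂ)) : ∃ h : C(X, ℂ), Set.EqOn h f K ∧ Set.EqOn (h ∘ φ) g K := by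
  have := isCompact_iff_compactSpace.1 hK
  let e : K ⊕ K → OnePoint X := Sum.elim (fun x => ((x : X) : OnePoint X))
    (fun x => ((φ x : X) : OnePoint X))
  have hne : ∀ a b : K, φ a ≠ b := fun a b hab =>
    Set.notMem_empty (b : X) (hdisj ▸ ⟨⟨a, a.2, hab⟩, b.2⟩)
  have he : Continuous e :=
    (OnePoint.continuous_coe.comp continuous_subtype_val).sumElim
      (OnePoint.continuous_coe.comp (hφ.comp continuous_subtype_val))
  have hei : Injective e := by
    refine Injective.sumElim (OnePoint.coe_injective.comp Subtype.val_injective)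
      (OnePoint.coe_injective.comp (hinj.comp Subtype.val_injective)) fun a b hab => ?_
    exact hne b a (OnePoint.coe_injective hab).symm
  let F : C(K ⊕ K, ℂ) :=
    ⟨Sum.elim (fun x => f x) (fun x => g x), by fun_prop⟩
  obtain ⟨G, hG⟩ := F.exists_extension (he.isClosedEmbedding hei)
  refine ⟨G.comp ⟨_, OnePoint.continuous_coe⟩, fun x hx => ?_, fun x hx => ?_⟩
  · exact DFunLike.congr_fun hG (Sum.inl ⟨x, hx⟩)
  · exact DFunLike.congr_fun hG (Sum.inr ⟨x, hx⟩)

lemma topMixing_of_strongRunAway [LocallyCompactSpace X] [T2Space X] {w : C(X, ℂ)} {ψ : C(X, X)}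
    (hw : ∀ x, w x ≠ 0) (hinj : Injective ψ) (hrun : StrongRunAway ψ) :
    TopMixing (fun f : C(X, ℂ) => w * f.comp ψ) := by
  rintro U V hU hV ⟨f, hf⟩ ⟨g, hg⟩
  obtain ⟨K, hK, hKU⟩ := exists_isCompact_forall_eqOn_mem hU hf
  obtain ⟨L, hL, hLV⟩ := exists_isCompact_forall_eqOn_mem hV hg
  obtain ⟨M, hM⟩ := hrun (K ∪ L) (hK.union hL)
  refine ⟨M, fun m hm => ?_⟩
  have hprod : ∀ x, ∏ i ∈ Finset.range m, w (ψ^[i] x) ≠ 0 :=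
    fun x => Finset.prod_ne_zero_iff.2 fun i _ => hw _
  have hcont : Continuous fun x => ∏ i ∈ Finset.range m, w (ψ^[i] x) :=
    continuous_finsetProd _ fun i _ => w.continuous.comp (ψ.continuous.iterate i)
  obtain ⟨h, hh₁, hh₂⟩ := exists_eqOn_comp_eqOn (hK.union hL) (ψ.continuous.iterate m)
    (hinj.iterate m) (hM m hm) f ⟨_, g.continuous.div hcont hprod⟩
  refine ⟨_, ⟨h, hKU h (hh₁.mono Set.subset_union_left), rfl⟩, hLV _ fun x hx => ?_⟩
  have hx' : h (ψ^[m] x) = g x / _ := hh₂ (Set.mem_union_right K hx)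
  rw [iterate_mul_comp_apply, hx', mul_div_cancel₀ _ (hprod x)]

lemma TopMixing.weight_ne_zero {w : C(X, ℂ)} {ψ : C(X, X)}
    (h : TopMixing (fun f : C(X, ℂ) => w * f.comp ψ)) (x : X) : w x ≠ 0 := by
  intro hx
  obtain ⟨M, hM⟩ := h Set.univ {g | g x ≠ 0} isOpen_univ
    (isOpen_ne.preimage (continuous_eval_const x)) Set.univ_nonempty ⟨1, by simp⟩
  obtain ⟨_, ⟨f, -, rfl⟩, hf⟩ := hM (M + 1) M.le_succ
  apply hf
  rw [iterate_succ_apply']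
  simp [hx]

lemma TopMixing.injective [LocallyCompactSpace X] [T2Space X] {w : C(X, ℂ)} {ψ : C(X, X)}
    (h : TopMixing (fun f : C(X, ℂ) => w * f.comp ψ)) : Injective ψ := by
  intro x y hxy
  by_contra hne
  obtain ⟨g, hgx, hgy, -⟩ := exists_continuous_one_zero_of_isCompact (isCompact_singleton (x := x))
    (isClosed_singleton (x := y)) (Set.disjoint_singleton.2 hne)
  have hgx' : g x = 1 := hgx rfl
  have hgy' : g y = 0 := hgy rfl
  obtain ⟨M, hM⟩ := h Set.univ {g | g x * w y ≠ g y * w x} isOpen_univ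
    (isOpen_ne_fun ((continuous_eval_const x).mul continuous_const)
      ((continuous_eval_const y).mul continuous_const)) Set.univ_nonempty
    ⟨⟨fun z => (g z : ℂ), by fun_prop⟩, by simp [hgx', hgy', h.weight_ne_zero y]⟩
  obtain ⟨_, ⟨f, -, rfl⟩, hf⟩ := hM (M + 1) M.le_succ
  apply hf
  rw [iterate_succ_apply']
  simp only [ContinuousMap.mul_apply, ContinuousMap.comp_apply, hxy]
  ring

lemma TopMixing.strongRunAway {w : C(X, ℂ)} {ψ : C(X, X)}
    (h : TopMixing (fun f : C(X, ℂ) => w * f.comp ψ)) : StrongRunAway ψ := by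
  intro K hK
  have hsmall : IsOpen {f : C(X, ℂ) | Set.MapsTo f K {z | ‖z‖ < 1}} :=
    ContinuousMap.isOpen_setOfPred_mapsTo hK (isOpen_lt continuous_norm continuous_const)
  have hlarge : IsOpen {f : C(X, ℂ) | Set.MapsTo f K {z | 1 < ‖z‖}} :=
    ContinuousMap.isOpen_setOfPred_mapsTo hK (isOpen_lt continuous_const continuous_norm)
  have hsmall' : {f : C(X, ℂ) | Set.MapsTo f K {z | ‖z‖ < 1}}.Nonempty :=
    ⟨0, fun x _ => by simp⟩
  have hlarge' : {f : C(X, ℂ) | Set.MapsTo f K {z | 1 < ‖z‖}}.Nonempty :=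
    ⟨ContinuousMap.const X 2, fun x _ => by simp⟩
  obtain ⟨M, hM⟩ := h _ _ hsmall hlarge hsmall' hlarge'
  obtain ⟨N, hN⟩ := h _ _ hlarge hsmall hlarge' hsmall'
  refine ⟨max M N, fun m hm => Set.eq_empty_iff_forall_notMem.2 ?_⟩
  rintro _ ⟨⟨x, hx, rfl⟩, hxm⟩
  obtain ⟨_, ⟨f, hf, rfl⟩, hf'⟩ := hM m (le_of_max_le_left hm)
  obtain ⟨_, ⟨g, hg, rfl⟩, hg'⟩ := hN m (le_of_max_le_right hm)
  have h₁ : ‖f (ψ^[m] x)‖ < 1 := hf hxm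
  have h₂ := hf' hx
  have h₃ : 1 < ‖g (ψ^[m] x)‖ := hg hxm
  have h₄ := hg' hx
  rw [Set.mem_ofPred_eq, iterate_mul_comp_apply, norm_mul] at h₂ h₄
  have := norm_nonneg (∏ i ∈ Finset.range m, w (ψ^[i] x))
  nlinarith

end WeightedComposition

/-- for `Ω` a locally compact, σ-compact, non-compact Hausdorff space, `X ⊆ Ω`
open and nonempty, `w : X → ℂ` continuous and `ψ : X → X` continuous and open, the weighted
composition operator `f ↦ w·(f∘ψ)` on `C(X, ℂ)` is topologically mixing iff `w` has no zeros,
`ψ` is injective and strong run-away. -/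
theorem stmt5 {Ω : Type*} [TopologicalSpace Ω] [LocallyCompactSpace Ω]
    [SigmaCompactSpace Ω] [NoncompactSpace Ω] [T2Space Ω]
    (X : Set Ω) (hXopen : IsOpen X) (hXne : X.Nonempty)
    (w : C(↥X, ℂ)) (ψ : C(↥X, ↥X)) (hψopen : IsOpenMap ψ) :
    TopMixing (fun f : C(↥X, ℂ) => w * f.comp ψ) ↔
      ((∀ x : ↥X, w x ≠ 0) ∧ Function.Injective ψ ∧ StrongRunAway ⇑ψ) := by
  have : LocallyCompactSpace X := hXopen.locallyCompactSpace
  exact ⟨fun h => ⟨h.weight_ne_zero, h.injective, h.strongRunAway⟩,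
    fun ⟨hw, hinj, hrun⟩ => topMixing_of_strongRunAway hw hinj hrun⟩
end

section
/- Let d ≥ 1 and let K₁ and K₂ be compact subsets of ℝ^d that are homeomorphic to each other (as topological spaces with the subspace topology). Then the complements ℝ^d \ K₁ and ℝ^d \ K₂ have the same number of connected components; that is, there exists a bijection between the set of connected components of ℝ^d \ K₁ and the set of connected components of ℝ^d \ K₂. -/
open Set Filter Topology MeasureTheory Metric Function
open scoped ContDiff

section Piola

variable {ι E : Type*} [Fintype ι] [DecidableEq ι] [NormedAddCommGroup E] [NormedSpace ℝ E]

theorem Module.Basis.sum_det_update_smul (b : Module.Basis ι ℝ E) (v : ι → E) (w : E) :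
    ∑ j, b.det (update v j w) • v j = b.det v • w := by
  have h := Matrix.mulVec_cramer (b.toMatrix v) (b.repr w)
  apply b.repr.injective
  ext i
  have hi := congrFun h i
  simp only [Matrix.mulVec, dotProduct, Matrix.cramer_apply, Pi.smul_apply, smul_eq_mul] at hi
  simp only [map_sum, map_smul, Finsupp.coe_finsetSum, Finset.sum_apply, Finsupp.smul_apply,
    smul_eq_mul, Module.Basis.det_apply]
  rw [← hi]
  refine Finset.sum_congr rfl fun j _ => ?_
  rw [Module.Basis.toMatrix_update, mul_comm]
  rfl

theorem AlternatingMap.sum_update_update_eq_zero (D : E [⋀^ι]→ₗ[ℝ] ℝ) (A : ι → E) (h : E)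
    (S : ι → ι → E) (hS : ∀ i j, S i j = S j i) :
    ∑ j, ∑ i, (if i = j then 0 else D (update (update A j h) i (S j i))) = 0 := by
  have key : ∀ i j, (if i = j then 0 else D (update (update A j h) i (S j i))) =
      -(if j = i then 0 else D (update (update A i h) j (S i j))) := by
    intro i j
    by_cases hij : i = j
    · simp [hij]
    · rw [if_neg hij, if_neg (Ne.symm hij), ← D.map_swap _ hij, hS i j]
      congr 1
      ext k
      by_cases h1 : k = i
      · subst h1; simp
      · by_cases h2 : k = j
        · subst h2; simp [h1, hij]
        · simp [Equiv.swap_apply_of_ne_of_ne h1 h2, h1, h2]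
  have h2 : ∑ j, ∑ i, (if i = j then 0 else D (update (update A j h) i (S j i))) =
      -∑ j, ∑ i, (if i = j then 0 else D (update (update A j h) i (S j i))) := by
    conv_lhs => rw [Finset.sum_comm]
    rw [← Finset.sum_neg_distrib]
    refine Finset.sum_congr rfl fun i _ => ?_
    rw [← Finset.sum_neg_distrib]
    exact Finset.sum_congr rfl fun j _ => key i j
  linarith

variable [FiniteDimensional ℝ E]

/-- The determinant with respect to a basis, as a continuous multilinear map. -/
noncomputable def Module.Basis.continuousDet (b : Module.Basis ι ℝ E) :
    ContinuousMultilinearMap ℝ (fun _ : ι => E) ℝ where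
  toMultilinearMap := b.det.toMultilinearMap
  cont := by
    change Continuous fun v : ι → E => b.det v
    simp only [Module.Basis.det_apply]
    refine Continuous.matrix_det (continuous_matrix fun i j => ?_)
    simp only [Module.Basis.toMatrix_apply]
    exact (LinearMap.continuous_of_finiteDimensional (b.coord i)).comp (continuous_apply j)

theorem Module.Basis.continuousDet_apply (b : Module.Basis ι ℝ E) (v : ι → E) :
    b.continuousDet v = b.det v := rfl

theorem ContinuousLinearMap.det_eq_continuousDet (b : Module.Basis ι ℝ E) (L : E →L[ℝ] E) :
    L.det = b.continuousDet fun i => L (b i) := by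
  have h := b.det_comp (L : E →ₗ[ℝ] E) b
  rw [b.det_self, mul_one] at h
  exact h.symm

/-- The components of the vector field whose divergence is the first variation of
`φ (F x) * det (fderiv ℝ F x)` in the direction `H`. -/
noncomputable def variationField (b : Module.Basis ι ℝ E) (φ : E → ℝ) (F H : E → E) (j : ι)
    (x : E) : ℝ :=
  φ (F x) * b.continuousDet (update (fun i => fderiv ℝ F x (b i)) j (H x))

/-- The first variation of `φ (F x) * det (fderiv ℝ F x)` in the direction `H`. -/
noncomputable def firstVariation (b : Module.Basis ι ℝ E) (φ : E → ℝ) (F H : E → E) (x : E) : ℝ :=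
  fderiv ℝ φ (F x) (H x) * b.continuousDet (fun i => fderiv ℝ F x (b i)) +
    φ (F x) * ∑ j, b.continuousDet
      (update (fun i => fderiv ℝ F x (b i)) j (fderiv ℝ H x (b j)))

variable {φ : E → ℝ} {F H : E → E}

theorem contDiff_variationField (b : Module.Basis ι ℝ E) (hφ : ContDiff ℝ ∞ φ)
    (hF : ContDiff ℝ ∞ F) (hH : ContDiff ℝ ∞ H) (j : ι) :
    ContDiff ℝ ∞ (variationField b φ F H j) := by
  refine (hφ.comp hF).mul (b.continuousDet.contDiff.comp (contDiff_pi.2 fun i => ?_))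
  by_cases hij : i = j
  · subst hij; simpa using hH
  · simpa [hij] using (hF.fderiv_right (m := ∞) (by simp)).clm_apply contDiff_const

theorem sum_fderiv_variationField (b : Module.Basis ι ℝ E) (hφ : ContDiff ℝ ∞ φ)
    (hF : ContDiff ℝ ∞ F) (hH : ContDiff ℝ ∞ H) (x : E) :
    ∑ j, fderiv ℝ (variationField b φ F H j) x (b j) = firstVariation b φ F H x := by
  have hFd : HasFDerivAt F (fderiv ℝ F x) x := (hF.differentiable (by simp) x).hasFDerivAt
  have hHd : HasFDerivAt H (fderiv ℝ H x) x := (hH.differentiable (by simp) x).hasFDerivAt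
  have hφd : HasFDerivAt φ (fderiv ℝ φ (F x)) (F x) :=
    (hφ.differentiable (by simp) _).hasFDerivAt
  have hF2 : HasFDerivAt (fderiv ℝ F) (fderiv ℝ (fderiv ℝ F) x) x :=
    ((hF.fderiv_right (m := ∞) (by simp)).differentiable (by simp) x).hasFDerivAt
  have hsymm : ∀ v w, fderiv ℝ (fderiv ℝ F) x v w = fderiv ℝ (fderiv ℝ F) x w v :=
    (hF.contDiffAt.isSymmSndFDerivAt (n := ∞) (by simpa using ENat.LEInfty.out))
  set A : ι → E := fun i => fderiv ℝ F x (b i) with hA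
  have hA2 : ∀ i, HasFDerivAt (fun y => fderiv ℝ F y (b i))
      ((ContinuousLinearMap.apply ℝ E (b i)).comp (fderiv ℝ (fderiv ℝ F) x)) x := fun i =>
    (ContinuousLinearMap.apply ℝ E (b i)).hasFDerivAt.comp x hF2
  have hV : ∀ j, fderiv ℝ (variationField b φ F H j) x (b j) =
      fderiv ℝ φ (F x) (b.det (update A j (H x)) • A j) +
      φ (F x) * (b.continuousDet (update A j (fderiv ℝ H x (b j))) +
        ∑ i, if i = j then 0 else
          b.det (update (update A j (H x)) i (fderiv ℝ (fderiv ℝ F) x (b j) (b i)))) := by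
    intro j
    have hg : ∀ i, HasFDerivAt (fun y => update (fun i => fderiv ℝ F y (b i)) j (H y) i)
        (if i = j then fderiv ℝ H x else
          (ContinuousLinearMap.apply ℝ E (b i)).comp (fderiv ℝ (fderiv ℝ F) x)) x := by
      intro i
      by_cases hij : i = j
      · subst hij; simpa using hHd
      · simpa [hij] using hA2 i
    have h1 := (hφd.comp x hFd).mul (HasFDerivAt.multilinear_comp (f := b.continuousDet) hg)
    have h2 : HasFDerivAt (variationField b φ F H j) _ x := h1
    rw [h2.fderiv]
    simp only [add_apply, smul_apply,
      ContinuousLinearMap.comp_apply, sum_apply, smul_eq_mul, map_smul,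
      comp_apply]
    rw [add_comm]
    congr 2
    rw [← Finset.add_sum_erase _ _ (Finset.mem_univ j)]
    congr 1
    · simp [ContinuousMultilinearMap.toContinuousLinearMap_apply, hA]
    · rw [← Finset.add_sum_erase (Finset.univ) (fun i => if i = j then (0 : ℝ) else _)
        (Finset.mem_univ j)]
      rw [if_pos rfl, zero_add]
      refine Finset.sum_congr rfl fun i hi => ?_
      have hij : i ≠ j := Finset.ne_of_mem_erase hi
      simp [ContinuousMultilinearMap.toContinuousLinearMap_apply, hA, hij,
        Module.Basis.continuousDet_apply]
  simp only [hV, firstVariation, Finset.sum_add_distrib, ← Finset.mul_sum, ← map_sum,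
    b.sum_det_update_smul]
  rw [b.det.sum_update_update_eq_zero A (H x)
    (fun j i => fderiv ℝ (fderiv ℝ F) x (b j) (b i)) (fun i j => hsymm _ _)]
  simp [Module.Basis.continuousDet_apply, hA, mul_comm]

theorem hasDerivAt_firstVariation (b : Module.Basis ι ℝ E) (hφ : ContDiff ℝ ∞ φ)
    (hF : ContDiff ℝ ∞ F) (hH : ContDiff ℝ ∞ H) (x : E) (t : ℝ) :
    HasDerivAt (fun s : ℝ => φ (F x + s • H x) * (fderiv ℝ (fun y => F y + s • H y) x).det)
      (firstVariation b φ (fun y => F y + t • H y) H x) t := by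
  have hFd : DifferentiableAt ℝ F x := hF.differentiable (by simp) x
  have hHd : DifferentiableAt ℝ H x := hH.differentiable (by simp) x
  have hfd : ∀ s : ℝ, fderiv ℝ (fun y => F y + s • H y) x = fderiv ℝ F x + s • fderiv ℝ H x :=
    fun s => (hFd.hasFDerivAt.add (hHd.hasFDerivAt.const_smul s)).fderiv
  simp only [ContinuousLinearMap.det_eq_continuousDet b, firstVariation, hfd]
  have hline : ∀ u v : E, HasDerivAt (fun s : ℝ => u + s • v) v t := fun u v => by
    simpa using ((hasDerivAt_id t).smul_const v).const_add u
  have h1 : HasDerivAt (fun s : ℝ => φ (F x + s • H x)) (fderiv ℝ φ (F x + t • H x) (H x)) t :=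
    (hφ.differentiable (by simp) _).hasFDerivAt.comp_hasDerivAt t (hline _ _)
  have h2 := (HasFDerivAt.multilinear_comp (f := b.continuousDet) (x := t)
    (g := fun i (s : ℝ) => fderiv ℝ F x (b i) + s • fderiv ℝ H x (b i))
    fun i => (hline _ _).hasFDerivAt).hasDerivAt
  refine (h1.mul h2).congr_deriv ?_
  simp [ContinuousMultilinearMap.toContinuousLinearMap_apply]

end Piola

section DegreeIntegral

theorem integral_fderiv_apply_eq_zero {E : Type*} [NormedAddCommGroup E] [NormedSpace ℝ E]
    [FiniteDimensional ℝ E] [MeasurableSpace E] [BorelSpace E] (μ : Measure E)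
    [μ.IsAddHaarMeasure] {V : E → ℝ} (hV : ContDiff ℝ 1 V) (hc : HasCompactSupport V) (v : E) :
    ∫ x, fderiv ℝ V x v ∂μ = 0 := by
  have hInt : Integrable (fun x => fderiv ℝ V x v) μ :=
    ((hV.continuous_fderiv (by simp)).clm_apply continuous_const).integrable_of_hasCompactSupport
      (hc.fderiv_apply ℝ v)
  have h := integral_mul_fderiv_eq_neg_fderiv_mul_of_integrable (μ := μ)
    (f := fun _ : E => (1 : ℝ)) (g := V) (v := v) (by simp) (by simpa using hInt)
    (by simpa using hV.continuous.integrable_of_hasCompactSupport hc)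
    (fun x _ => differentiableAt_const _) (fun x _ => hV.differentiable (by simp) x)
  simpa using h

theorem setIntegral_setIntegral_swap_of_isCompact {X Y : Type*} [TopologicalSpace X]
    [TopologicalSpace Y] [T2Space X] [T2Space Y] [SecondCountableTopology X]
    [SecondCountableTopology Y] [MeasurableSpace X] [MeasurableSpace Y] [BorelSpace X]
    [BorelSpace Y] (μ : Measure X) (ν : Measure Y) [IsFiniteMeasureOnCompacts μ]
    [IsFiniteMeasureOnCompacts ν] [SFinite μ] [SFinite ν] {f : X → Y → ℝ}
    (hf : Continuous (uncurry f)) {s : Set X} {t : Set Y} (hs : IsCompact s) (ht : IsCompact t) :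
    ∫ x in s, ∫ y in t, f x y ∂ν ∂μ = ∫ y in t, ∫ x in s, f x y ∂μ ∂ν := by
  refine integral_integral_swap ?_
  rw [Measure.prod_restrict]
  refine hf.continuousOn.integrableOn_of_subset_isCompact (hs.prod ht)
    (hs.measurableSet.prod ht.measurableSet) subset_rfl ?_
  rw [Measure.prod_prod]
  exact (ENNReal.mul_lt_top hs.measure_lt_top ht.measure_lt_top).ne

theorem contDiff_det_fderiv {E : Type*} [NormedAddCommGroup E] [NormedSpace ℝ E]
    [FiniteDimensional ℝ E] {F : E → E} (hF : ContDiff ℝ ∞ F) :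
    ContDiff ℝ ∞ fun x => (fderiv ℝ F x).det := by
  classical
  simp only [ContinuousLinearMap.det_eq_continuousDet (Module.finBasis ℝ E)]
  exact (Module.finBasis ℝ E).continuousDet.contDiff.comp
    (contDiff_pi.2 fun i => (hF.fderiv_right (m := ∞) (by simp)).clm_apply contDiff_const)

variable {E : Type*} [NormedAddCommGroup E] [NormedSpace ℝ E]
  [MeasurableSpace E] (μ : Measure E)

/-- The integral over `U` of the pullback under `F` of the top form with density `φ`. -/
noncomputable def degreeIntegral (U : Set E) (F : E → E) (φ : E → ℝ) : ℝ :=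
  ∫ x in U, φ (F x) * (fderiv ℝ F x).det ∂μ

variable {μ} {U N : Set E} {F H : E → E} {φ : E → ℝ}

theorem degreeIntegral_comp {G : E → E} (hG : ContDiff ℝ ∞ G)
    (hF : ContDiff ℝ ∞ F) : degreeIntegral μ U (G ∘ F) φ =
      degreeIntegral μ U F fun y => φ (G y) * (fderiv ℝ G y).det := by
  simp only [degreeIntegral]
  congr 1
  ext x
  rw [fderiv_comp x (hG.differentiable (by simp) _) (hF.differentiable (by simp) _), mul_assoc]
  congr 1
  exact LinearMap.det_comp _ _

theorem degreeIntegral_id :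
    degreeIntegral μ U (fun x => x) φ = ∫ x in U, φ x ∂μ := by
  simp [degreeIntegral, ContinuousLinearMap.det]

variable [BorelSpace E]

theorem degreeIntegral_eq_diff (hU : IsOpen U) (h0 : ∀ x ∈ N, φ (F x) = 0) :
    degreeIntegral μ U F φ = ∫ x in U \ N, φ (F x) * (fderiv ℝ F x).det ∂μ := by
  refine setIntegral_eq_of_subset_of_forall_sdiff_eq_zero hU.measurableSet sdiff_subset ?_
  rintro x ⟨hx, hxN⟩
  rw [h0 x (by by_contra h; exact hxN ⟨hx, h⟩), zero_mul]

variable [FiniteDimensional ℝ E] [μ.IsAddHaarMeasure]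

theorem setIntegral_firstVariation_eq_zero {ι : Type*} [Fintype ι] [DecidableEq ι]
    (b : Module.Basis ι ℝ E) (hφ : ContDiff ℝ ∞ φ) (hF : ContDiff ℝ ∞ F) (hH : ContDiff ℝ ∞ H)
    (hU : IsOpen U) (hQ : IsCompact (U \ N)) (h0 : ∀ x ∈ N, φ (F x) = 0) :
    ∫ x in U \ N, firstVariation b φ F H x ∂μ = 0 := by
  set V : ι → E → ℝ := fun j => U.indicator (variationField b φ F H j) with hVdef
  have hz : ∀ j, ∀ x ∈ (U \ N)ᶜ, V j x = 0 := by
    intro j x hx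
    by_cases hxU : x ∈ U
    · have hxN : x ∈ N := by by_contra h; exact hx ⟨hxU, h⟩
      simp [hVdef, hxU, variationField, h0 x hxN]
    · simp [hVdef, hxU]
  have hin : ∀ j, ∀ x ∈ U, V j =ᶠ[𝓝 x] variationField b φ F H j := fun j x hx => by
    filter_upwards [hU.mem_nhds hx] with y hy using indicator_of_mem hy _
  have hout : ∀ j, ∀ x ∉ U \ N, V j =ᶠ[𝓝 x] fun _ => 0 := fun j x hx => by
    filter_upwards [hQ.isClosed.isOpen_compl.mem_nhds hx] with y hy using hz j y hy
  have hV : ∀ j, ContDiff ℝ 1 (V j) := fun j => contDiff_iff_contDiffAt.2 fun x => by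
    by_cases hx : x ∈ U
    · exact ((contDiff_variationField b hφ hF hH j).of_le
        (by simp)).contDiffAt.congr_of_eventuallyEq (hin j x hx)
    · exact contDiffAt_const.congr_of_eventuallyEq (hout j x fun h => hx h.1)
  have heq : ∀ x, (U \ N).indicator (firstVariation b φ F H) x =
      ∑ j, fderiv ℝ (V j) x (b j) := by
    intro x
    by_cases hx : x ∈ U \ N
    · rw [indicator_of_mem hx, ← sum_fderiv_variationField b hφ hF hH]
      exact Finset.sum_congr rfl fun j _ => by rw [(hin j x hx.1).fderiv_eq]
    · rw [indicator_of_notMem hx]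
      exact (Finset.sum_eq_zero fun j _ => by rw [(hout j x hx).fderiv_eq]; simp).symm
  have hVc : ∀ j, HasCompactSupport (V j) := fun j =>
    HasCompactSupport.intro hQ fun x hx => hz j x hx
  rw [← integral_indicator hQ.measurableSet, integral_congr_ae (ae_of_all _ heq),
    integral_finsetSum]
  · exact Finset.sum_eq_zero fun j _ => integral_fderiv_apply_eq_zero μ (hV j) (hVc j) _
  · exact fun j _ => (((hV j).continuous_fderiv (by simp)).clm_apply
      continuous_const).integrable_of_hasCompactSupport ((hVc j).fderiv_apply ℝ _)

/-- Homotopy invariance of the degree integral along the straight line from `F` to `F + H`. -/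
theorem degreeIntegral_add_eq (hφ : ContDiff ℝ ∞ φ) (hF : ContDiff ℝ ∞ F) (hH : ContDiff ℝ ∞ H)
    (hU : IsOpen U) (hQ : IsCompact (U \ N))
    (h0 : ∀ x ∈ N, ∀ t ∈ Icc (0 : ℝ) 1, φ (F x + t • H x) = 0) :
    degreeIntegral μ U (fun x => F x + H x) φ = degreeIntegral μ U F φ := by
  classical
  set b := Module.finBasis ℝ E
  have hFt : ∀ t : ℝ, ContDiff ℝ ∞ fun y => F y + t • H y := fun t =>
    hF.add (contDiff_const.smul hH)
  have hcont : Continuous (uncurry fun x (t : ℝ) =>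
      firstVariation b φ (fun y => F y + t • H y) H x) := by
    have hfd : ∀ (t : ℝ) x, fderiv ℝ (fun y => F y + t • H y) x =
        fderiv ℝ F x + t • fderiv ℝ H x := fun t x =>
      ((hF.differentiable (by simp) x).hasFDerivAt.add
        ((hH.differentiable (by simp) x).hasFDerivAt.const_smul t)).fderiv
    have hφ' := hφ.continuous_fderiv (by simp)
    have hF' := hF.continuous_fderiv (by simp)
    have hH' := hH.continuous_fderiv (by simp)
    have hφc := hφ.continuous
    have hFc := hF.continuous
    have hHc := hH.continuous
    have hA : Continuous fun p : E × ℝ =>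
        fun i => (fderiv ℝ F p.1 + p.2 • fderiv ℝ H p.1) (b i) := by fun_prop
    simp only [firstVariation, hfd, uncurry_def]
    refine Continuous.add (Continuous.mul (by fun_prop) (b.continuousDet.cont.comp hA))
      (Continuous.mul (by fun_prop) (continuous_finsetSum _ fun j _ =>
        b.continuousDet.cont.comp (hA.update j (by fun_prop))))
  have h1 : ∀ x, φ (F x + H x) * (fderiv ℝ (fun y => F y + H y) x).det -
      φ (F x) * (fderiv ℝ F x).det =
      ∫ t in Icc (0 : ℝ) 1, firstVariation b φ (fun y => F y + t • H y) H x := by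
    intro x
    rw [integral_Icc_eq_integral_Ioc, ← intervalIntegral.integral_of_le zero_le_one,
      intervalIntegral.integral_eq_sub_of_hasDerivAt
        (fun t _ => hasDerivAt_firstVariation b hφ hF hH x t)
        ((hcont.comp (Continuous.prodMk_right x)).intervalIntegrable (μ := volume) 0 1)]
    simp
  have hN0 : ∀ x ∈ N, φ (F x) = 0 := fun x hx => by simpa using h0 x hx 0 (by simp)
  have hN1 : ∀ x ∈ N, φ (F x + H x) = 0 := fun x hx => by simpa using h0 x hx 1 (by simp)
  have hInt : ∀ {G : E → E}, ContDiff ℝ ∞ G →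
      IntegrableOn (fun x => φ (G x) * (fderiv ℝ G x).det) (U \ N) μ := fun hG =>
    ((hφ.continuous.comp hG.continuous).mul
      (contDiff_det_fderiv hG).continuous).continuousOn.integrableOn_compact hQ
  rw [degreeIntegral_eq_diff hU hN0, degreeIntegral_eq_diff (N := N) hU hN1, ← sub_eq_zero,
    ← integral_sub (hInt (hF.add hH)) (hInt hF)]
  simp only [h1]
  rw [setIntegral_setIntegral_swap_of_isCompact μ volume hcont hQ isCompact_Icc]
  refine setIntegral_eq_zero_of_forall_eq_zero fun t ht => ?_
  exact setIntegral_firstVariation_eq_zero b hφ (hFt t) hH hU hQ fun x hx => h0 x hx t ht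

/-- The degree integral of `θ` is the average against `θ` of the degree integrals of the
translates of a normalised bump function `ρ`. -/
theorem degreeIntegral_eq_integral_mul {θ ρ : E → ℝ} {δ : ℝ} (hθ : ContDiff ℝ ∞ θ)
    (hθc : HasCompactSupport θ) (hρ : ContDiff ℝ ∞ ρ) (hρδ : ∀ z, δ < ‖z‖ → ρ z = 0)
    (hρ1 : ∫ z, ρ z ∂μ = 1) (hF : ContDiff ℝ ∞ F) (hU : IsOpen U) (hQ : IsCompact (U \ N))
    (h0 : ∀ x ∈ N, ∀ z, ‖z‖ ≤ δ → θ (F x - z) = 0) :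
    degreeIntegral μ U F θ = ∫ y, θ y * degreeIntegral μ U F (fun w => ρ (w - y)) ∂μ := by
  have hJ := (contDiff_det_fderiv hF).continuous
  have hFc := hF.continuous
  have hθ' := hθ.continuous
  have hρ' := hρ.continuous
  have htrans : ∀ z, ‖z‖ ≤ δ → degreeIntegral μ U F θ =
      ∫ x in U \ N, θ (F x - z) * (fderiv ℝ F x).det ∂μ := by
    intro z hz
    have h := degreeIntegral_add_eq (μ := μ) (H := fun _ => -z) hθ hF contDiff_const hU hQ
      (fun x hx t ht => by
        have := h0 x hx (t • z) (by
          rw [norm_smul, Real.norm_eq_abs, abs_of_nonneg ht.1]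
          exact (mul_le_of_le_one_left (norm_nonneg _) ht.2).trans hz)
        simpa [sub_eq_add_neg] using this)
    rw [← h, degreeIntegral_eq_diff (N := N) hU fun x hx => by
      simpa [sub_eq_add_neg] using h0 x hx z hz]
    simp [sub_eq_add_neg]
  have hB : ∀ f : E → ℝ, ∫ z in closedBall (0 : E) δ, ρ z * f z ∂μ = ∫ z, ρ z * f z ∂μ := fun f =>
    setIntegral_eq_integral_of_forall_compl_eq_zero fun z hz => by
      rw [hρδ z (by simpa using hz), zero_mul]
  have hT : ∀ f : E → ℝ, ∫ y in tsupport θ, θ y * f y ∂μ = ∫ y, θ y * f y ∂μ := fun f =>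
    setIntegral_eq_integral_of_forall_compl_eq_zero fun z hz => by
      rw [image_eq_zero_of_notMem_tsupport hz, zero_mul]
  have hc1 : ∀ J : E → ℝ, Continuous J →
      Continuous (uncurry fun z x => ρ z * (θ (F x - z) * J x)) := by
    intro J hJ
    fun_prop
  have hc2 : ∀ J : E → ℝ, Continuous J →
      Continuous (uncurry fun x y => θ y * (ρ (F x - y) * J x)) := by
    intro J hJ
    fun_prop
  calc degreeIntegral μ U F θ
      = ∫ z, ρ z * degreeIntegral μ U F θ ∂μ := by
        rw [integral_mul_const, hρ1, one_mul]
    _ = ∫ z in closedBall (0 : E) δ, ρ z * degreeIntegral μ U F θ ∂μ := (hB _).symm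
    _ = ∫ z in closedBall (0 : E) δ, ∫ x in U \ N,
          ρ z * (θ (F x - z) * (fderiv ℝ F x).det) ∂μ ∂μ := by
        refine setIntegral_congr_fun measurableSet_closedBall fun z hz => ?_
        rw [integral_const_mul, ← htrans z (by simpa using hz)]
    _ = ∫ x in U \ N, ∫ z in closedBall (0 : E) δ,
          ρ z * (θ (F x - z) * (fderiv ℝ F x).det) ∂μ ∂μ :=
        setIntegral_setIntegral_swap_of_isCompact μ μ (hc1 _ hJ) (isCompact_closedBall _ _) hQ
    _ = ∫ x in U \ N, ∫ y in tsupport θ,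
          θ y * (ρ (F x - y) * (fderiv ℝ F x).det) ∂μ ∂μ := by
        congr 1
        ext x
        rw [hB fun z => θ (F x - z) * (fderiv ℝ F x).det,
          hT fun y => ρ (F x - y) * (fderiv ℝ F x).det, ← integral_sub_left_eq_self _ μ (F x)]
        congr 1
        ext y
        rw [sub_sub_cancel]
        ring
    _ = ∫ y in tsupport θ, ∫ x in U \ N,
          θ y * (ρ (F x - y) * (fderiv ℝ F x).det) ∂μ ∂μ :=
        setIntegral_setIntegral_swap_of_isCompact μ μ (hc2 _ hJ) hQ hθc
    _ = ∫ y in tsupport θ, θ y * degreeIntegral μ U F (fun w => ρ (w - y)) ∂μ := by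
        congr 1
        ext y
        rw [integral_const_mul]
        by_cases hy : θ y = 0
        · simp [hy]
        rw [degreeIntegral_eq_diff (N := N) hU fun x hx => ?_]
        refine hρδ _ (lt_of_not_ge fun h => hy ?_)
        simpa using h0 x hx _ h
    _ = _ := hT _

end DegreeIntegral

section Components

variable {X : Type*} [TopologicalSpace X]

/-- A connected component of the complement of `K`, as a subset of the ambient space. -/
def complComponent (K : Set X) (c : ConnectedComponents ↥Kᶜ) : Set X :=
  Subtype.val '' (ConnectedComponents.mk ⁻¹' {c})

variable {K : Set X}

theorem complComponent_subset (c : ConnectedComponents ↥Kᶜ) : complComponent K c ⊆ Kᶜ := by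
  rintro _ ⟨x, -, rfl⟩
  exact x.2

theorem exists_mem_complComponent {x : X} (hx : x ∈ Kᶜ) : ∃ c, x ∈ complComponent K c :=
  ⟨ConnectedComponents.mk ⟨x, hx⟩, ⟨x, hx⟩, rfl, rfl⟩

theorem pairwise_disjoint_complComponent : Pairwise (Disjoint on complComponent K) := by
  intro c c' hne
  rw [Function.onFun, Set.disjoint_left]
  rintro _ ⟨x, hx, rfl⟩ ⟨y, hy, hxy⟩
  obtain rfl := Subtype.ext hxy
  exact hne (hx.symm.trans hy)

theorem isConnected_complComponent (c : ConnectedComponents ↥Kᶜ) :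
    IsConnected (complComponent K c) := by
  obtain ⟨x, rfl⟩ := ConnectedComponents.surjective_coe c
  rw [complComponent, connectedComponents_preimage_singleton]
  exact isConnected_connectedComponent.image _ continuous_subtype_val.continuousOn

theorem isOpen_complComponent [LocallyConnectedSpace X] (hK : IsClosed K)
    (c : ConnectedComponents ↥Kᶜ) : IsOpen (complComponent K c) := by
  have := hK.isOpen_compl.locallyConnectedSpace
  obtain ⟨x, rfl⟩ := ConnectedComponents.surjective_coe c
  rw [complComponent, connectedComponents_preimage_singleton]
  exact hK.isOpen_compl.isOpenMap_subtype_val _ isOpen_connectedComponent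

theorem closure_complComponent_subset [LocallyConnectedSpace X] (hK : IsClosed K)
    (c : ConnectedComponents ↥Kᶜ) : closure (complComponent K c) ⊆ complComponent K c ∪ K := by
  intro x hx
  by_contra h
  rw [Set.mem_union, not_or] at h
  obtain ⟨c', hc'⟩ := exists_mem_complComponent h.2
  have hne : c ≠ c' := by rintro rfl; exact h.1 hc'
  obtain ⟨y, hy, hy'⟩ := mem_closure_iff.1 hx _ (isOpen_complComponent hK c') hc'
  exact (pairwise_disjoint_complComponent hne).le_bot ⟨hy', hy⟩

theorem countable_connectedComponents_compl [LocallyConnectedSpace X]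
    [SecondCountableTopology X] (hK : IsClosed K) : Countable (ConnectedComponents ↥Kᶜ) :=
  (pairwise_disjoint_complComponent (K := K)).countable_of_isOpen_disjoint
    (isOpen_complComponent hK) fun c => (isConnected_complComponent c).nonempty

theorem setIntegral_complComponent_of_tsupport_subset
    [MeasurableSpace X] {μ : Measure X} [DecidableEq (ConnectedComponents ↥Kᶜ)] {ψ : X → ℝ}
    {c : ConnectedComponents ↥Kᶜ}
    (hψ : tsupport ψ ⊆ complComponent K c) (hψ1 : ∫ x, ψ x ∂μ = 1)
    (c' : ConnectedComponents ↥Kᶜ) :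
    ∫ x in complComponent K c', ψ x ∂μ = if c = c' then 1 else 0 := by
  split_ifs with h
  · subst h
    rw [← hψ1]
    exact setIntegral_eq_integral_of_forall_compl_eq_zero fun x hx =>
      image_eq_zero_of_notMem_tsupport fun h => hx (hψ h)
  · exact setIntegral_eq_zero_of_forall_eq_zero fun x hx =>
      image_eq_zero_of_notMem_tsupport fun h' =>
        (pairwise_disjoint_complComponent h).le_bot ⟨hψ h', hx⟩

end Components

section Approximation

variable {E : Type*} [NormedAddCommGroup E]

/-- A map which agrees with the identity outside of a bounded set. -/
def EqIdOutsideBounded (F : E → E) : Prop := ∃ R : ℝ, ∀ x, R < ‖x‖ → F x = x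

theorem EqIdOutsideBounded.comp {F G : E → E} (hG : EqIdOutsideBounded G)
    (hF : EqIdOutsideBounded F) : EqIdOutsideBounded (G ∘ F) := by
  obtain ⟨R, hR⟩ := hF
  obtain ⟨R', hR'⟩ := hG
  refine ⟨max R R', fun x hx => ?_⟩
  rw [comp_apply, hR x ((le_max_left _ _).trans_lt hx), hR' x ((le_max_right _ _).trans_lt hx)]

theorem EqIdOutsideBounded.isBounded_preimage {F : E → E} (hF : EqIdOutsideBounded F)
    {S : Set E} (hS : Bornology.IsBounded S) : Bornology.IsBounded (F ⁻¹' S) := by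
  obtain ⟨R, hR⟩ := hF
  refine (hS.union (isBounded_closedBall (x := (0 : E)) (r := R))).subset fun x hx => ?_
  by_cases h : R < ‖x‖
  · left
    rwa [mem_preimage, hR x h] at hx
  · right
    simpa using h

variable [NormedSpace ℝ E] [FiniteDimensional ℝ E]

theorem IsCompact.exists_isCompact_isConnected_superset {D S : Set E} (hD : IsOpen D)
    (hDc : IsConnected D) (hS : IsCompact S) (hSD : S ⊆ D) :
    ∃ T, IsCompact T ∧ IsConnected T ∧ S ⊆ T ∧ T ⊆ D := by
  obtain ⟨y, hy⟩ := hDc.nonempty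
  have hpath := (hD.isConnected_iff_isPathConnected.1 hDc).joinedIn y hy
  have hball : ∀ x ∈ D, ∃ r > 0, closedBall x r ⊆ D := fun x hx =>
    nhds_basis_closedBall.mem_iff.1 (hD.mem_nhds hx)
  choose! r hr hrD using hball
  have hγ : ∀ x ∈ D, ∃ P : Set E, IsCompact P ∧ IsConnected P ∧ y ∈ P ∧ x ∈ P ∧ P ⊆ D := by
    intro x hx
    obtain ⟨γ, hγ⟩ := hpath x hx
    exact ⟨range γ, isCompact_range γ.continuous, isConnected_range γ.continuous,
      ⟨0, γ.source⟩, ⟨1, γ.target⟩, range_subset_iff.2 hγ⟩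
  choose! P hPc hPconn hyP hxP hPD using hγ
  obtain ⟨t, htS, hSt⟩ := hS.elim_nhds_subcover (fun x => closedBall x (r x))
    fun x hx => closedBall_mem_nhds x (hr x (hSD hx))
  classical
  have ht : ∀ x ∈ insert y t, x ∈ D := fun x hx => by
    rcases Finset.mem_insert.1 hx with rfl | h
    exacts [hy, hSD (htS x h)]
  refine ⟨⋃ x ∈ insert y t, (P x ∪ closedBall x (r x)), ?_, ⟨⟨y, ?_⟩, ?_⟩, ?_, ?_⟩
  · exact (insert y t).isCompact_biUnion fun x hx =>
      (hPc x (ht x hx)).union (isCompact_closedBall _ _)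
  · exact mem_biUnion (Finset.mem_insert_self y t) (Or.inl (hyP y hy))
  · refine isPreconnected_of_forall y fun z hz => ?_
    obtain ⟨x, hx, hzx⟩ := mem_iUnion₂.1 hz
    have hxD := ht x hx
    exact ⟨_, subset_biUnion_of_mem (u := fun x => P x ∪ closedBall x (r x)) hx,
      Or.inl (hyP x hxD), hzx, (hPconn x hxD).isPreconnected.union x (hxP x hxD)
        (mem_closedBall_self (hr x hxD).le) (convex_closedBall x _).isPreconnected⟩
  · exact hSt.trans (iUnion₂_subset fun x hx => (subset_union_right).trans
      (subset_biUnion_of_mem (u := fun x => P x ∪ closedBall x (r x))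
        (Finset.mem_insert_of_mem hx)))
  · exact iUnion₂_subset fun x hx => union_subset (hPD x (ht x hx)) (hrD x (ht x hx))

theorem EqIdOutsideBounded.isCompact_preimage {F : E → E} (hF : EqIdOutsideBounded F)
    (hFc : Continuous F) {S : Set E} (hS : IsCompact S) : IsCompact (F ⁻¹' S) :=
  isCompact_of_isClosed_isBounded (hS.isClosed.preimage hFc) (hF.isBounded_preimage hS.isBounded)

theorem exists_contDiff_eqIdOutsideBounded_dist_lt {K : Set E} (hK : IsCompact K) {g : K → E}
    (hg : Continuous g) {ε : ℝ} (hε : 0 < ε) :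
    ∃ F : E → E, ContDiff ℝ ∞ F ∧ EqIdOutsideBounded F ∧ ∀ x : K, dist (F x) (g x) < ε := by
  obtain ⟨h, hh⟩ := ContinuousMap.exists_restrict_eq hK.isClosed
    (⟨fun x => g x - x, by fun_prop⟩ : C(K, E))
  obtain ⟨r, hr0, hr⟩ := hK.isBounded.subset_closedBall_lt 0 (0 : E)
  let χ : ContDiffBump (0 : E) := ⟨r, r + 1, hr0, by linarith⟩
  obtain ⟨P, hP, hPd⟩ := (HasCompactSupport.uniformContinuous_of_continuous
    (f := fun x => χ x • h x) χ.hasCompactSupport.smul_right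
    (χ.continuous.smul h.continuous)).exists_contDiff_dist_le hε
  refine ⟨fun x => x + χ x • P x, contDiff_id.add (χ.contDiff.smul hP), ⟨r + 1, fun x hx => ?_⟩,
    fun x => ?_⟩
  · dsimp only
    rw [χ.zero_of_le_dist (by simpa [χ] using hx.le), zero_smul, add_zero]
  · have h1 : χ x = 1 := χ.one_of_mem_closedBall (hr x.2)
    have h2 : h x = g x - x := DFunLike.congr_fun hh x
    have h3 := hPd x
    rw [h1, one_smul, h2] at h3
    dsimp only
    rw [h1, one_smul, ← dist_sub_right _ _ (x : E), add_sub_cancel_left]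
    exact h3

theorem exists_contDiff_bump_integral_eq_one [MeasurableSpace E] [BorelSpace E] (μ : Measure E)
    [μ.IsAddHaarMeasure] {x : E} {U : Set E} (hU : U ∈ 𝓝 x) :
    ∃ ψ : E → ℝ, ContDiff ℝ ∞ ψ ∧ HasCompactSupport ψ ∧ tsupport ψ ⊆ U ∧ ∫ y, ψ y ∂μ = 1 := by
  obtain ⟨r, hr, hrU⟩ := nhds_basis_closedBall.mem_iff.1 hU
  let χ : ContDiffBump x := ⟨r / 2, r, half_pos hr, half_lt_self hr⟩
  exact ⟨χ.normed μ, χ.contDiff_normed, χ.hasCompactSupport_normed,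
    by rwa [χ.tsupport_normed_eq], χ.integral_normed⟩

end Approximation

section Degree

variable {E : Type*} [NormedAddCommGroup E] [NormedSpace ℝ E] [FiniteDimensional ℝ E]

theorem isCompact_complComponent_diff {K N : Set E} (hK : IsClosed K)
    (c : ConnectedComponents ↥Kᶜ) (hN : IsOpen N) (hKN : K ⊆ N) (hNb : Bornology.IsBounded Nᶜ) :
    IsCompact (complComponent K c \ N) := by
  have h : complComponent K c \ N = closure (complComponent K c) \ N := by
    refine (sdiff_subset_sdiff_left subset_closure).antisymm fun x hx => ⟨?_, hx.2⟩
    exact (closure_complComponent_subset hK c hx.1).resolve_right fun h => hx.2 (hKN h)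
  rw [h]
  exact isCompact_of_isClosed_isBounded (isClosed_closure.sdiff hN) (hNb.subset fun x hx => hx.2)

variable [MeasurableSpace E] [BorelSpace E] {μ : Measure E} [μ.IsAddHaarMeasure]

theorem degreeIntegral_eq_setIntegral_of_dist_lt {K : Set E} (hK : IsClosed K)
    (c : ConnectedComponents ↥Kᶜ) {W : E → E} {ψ : E → ℝ} (hW : ContDiff ℝ ∞ W)
    (hWid : EqIdOutsideBounded W) (hψ : ContDiff ℝ ∞ ψ) (hψc : HasCompactSupport ψ)
    (hne : (tsupport ψ).Nonempty) (hWK : ∀ x ∈ K, dist (W x) x < infDist x (tsupport ψ)) :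
    degreeIntegral μ (complComponent K c) W ψ = ∫ x in complComponent K c, ψ x ∂μ := by
  set N : Set E := {x | dist (W x) x < infDist x (tsupport ψ)}
  have hN : IsOpen N :=
    isOpen_lt (hW.continuous.dist continuous_id) (continuous_infDist_pt _)
  have hNb : Bornology.IsBounded Nᶜ := by
    obtain ⟨R, hR⟩ := hWid
    refine (hψc.isBounded.union (isBounded_closedBall (x := (0 : E)) (r := R))).subset
      fun x hx => ?_
    by_contra h
    rw [mem_union, not_or] at h
    refine hx ?_
    change dist (W x) x < _
    rw [hR x (by simpa using h.2), dist_self]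
    exact (hψc.isClosed.notMem_iff_infDist_pos hne).1 h.1
  have h := degreeIntegral_add_eq (μ := μ) (H := fun x => x - W x) hψ hW (contDiff_id.sub hW)
    (isOpen_complComponent hK c) (isCompact_complComponent_diff hK c hN hWK hNb)
    (fun x hx t ht => by
      refine image_eq_zero_of_notMem_tsupport fun hmem => ?_
      have h1 : dist (W x) x < infDist x (tsupport ψ) := hx
      have h2 := infDist_le_dist_of_mem (x := x) hmem
      have h3 : dist x (W x + t • (x - W x)) ≤ dist (W x) x := by
        rw [dist_eq_norm, show x - (W x + t • (x - W x)) = (1 - t) • (x - W x) by module,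
          norm_smul, dist_comm, dist_eq_norm, Real.norm_eq_abs,
          abs_of_nonneg (sub_nonneg.2 ht.2)]
        exact mul_le_of_le_one_left (norm_nonneg _) (by linarith [ht.1])
      linarith)
  rw [← h, ← degreeIntegral_id]
  congr 1
  ext x
  simp

theorem degreeIntegral_translate_eq {U N T : Set E} {F : E → E} {ρ : E → ℝ} {δ : ℝ} (hδ : 0 < δ)
    (hρ : ContDiff ℝ ∞ ρ) (hρδ : ∀ z, δ < ‖z‖ → ρ z = 0) (hF : ContDiff ℝ ∞ F) (hU : IsOpen U)
    (hQ : IsCompact (U \ N)) (hT : IsPreconnected T)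
    (hNT : ∀ x ∈ N, ∀ y ∈ T, 2 * δ < dist (F x) y) {y y' : E} (hy : y ∈ T) (hy' : y' ∈ T) :
    degreeIntegral μ U F (fun w => ρ (w - y)) = degreeIntegral μ U F (fun w => ρ (w - y')) := by
  refine hT.induction₂ (fun y y' => degreeIntegral μ U F (fun w => ρ (w - y)) =
    degreeIntegral μ U F (fun w => ρ (w - y'))) (fun y hy => ?_)
    (fun _ _ _ _ _ _ => Eq.trans) (fun _ _ _ _ => Eq.symm) hy hy'
  filter_upwards [mem_nhdsWithin_of_mem_nhds (ball_mem_nhds y hδ)] with y' hy'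
  have h := degreeIntegral_add_eq (μ := μ) (F := F) (φ := fun w => ρ (w - y))
    (H := fun _ => y - y') (hρ.comp (contDiff_id.sub contDiff_const)) hF contDiff_const hU hQ
    (fun x hx t ht => hρδ _ (by
      have h1 := hNT x hx y hy
      have h2 : ‖t • (y - y')‖ ≤ δ := by
        rw [norm_smul, Real.norm_eq_abs, abs_of_nonneg ht.1, ← dist_eq_norm, dist_comm]
        exact (mul_le_of_le_one_left dist_nonneg ht.2).trans (mem_ball.1 hy').le
      have h3 := norm_sub_le (F x + t • (y - y') - y) (t • (y - y'))
      rw [show F x + t • (y - y') - y - t • (y - y') = F x - y by abel, ← dist_eq_norm] at h3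
      linarith))
  rw [← h]
  simp only [degreeIntegral, fderiv_add_const]
  congr 1
  ext x
  rw [show F x + (y - y') - y = F x - y' by abel]

end Degree

section Comparison

variable {E : Type*} [NormedAddCommGroup E] [NormedSpace ℝ E] [FiniteDimensional ℝ E]

theorem exists_isCompact_isConnected_complComponent {K S : Set E} (hK : IsClosed K)
    (hS : IsCompact S) (hSK : S ⊆ Kᶜ) (c : ConnectedComponents ↥Kᶜ) :
    ∃ T, IsCompact T ∧ IsConnected T ∧ S ∩ complComponent K c ⊆ T ∧ T ⊆ complComponent K c := by
  have h : S ∩ complComponent K c = S ∩ closure (complComponent K c) := by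
    refine (inter_subset_inter_right _ subset_closure).antisymm fun x hx => ⟨hx.1, ?_⟩
    exact (closure_complComponent_subset hK c hx.2).resolve_right (hSK hx.1)
  exact IsCompact.exists_isCompact_isConnected_superset (isOpen_complComponent hK c)
    (isConnected_complComponent c) (h ▸ hS.inter_right isClosed_closure) inter_subset_right

/-- Smooth approximations `F` and `G` of a homeomorphism and of its inverse, where `F` is chosen
after `G` and a compact set `T` which it should avoid. -/
theorem Homeomorph.exists_contDiff_approx {K₁ K₂ P : Set E} (h₁ : IsCompact K₁) (h₂ : IsCompact K₂)
    (e : K₁ ≃ₜ K₂) (hP : IsCompact P) (hPK : Disjoint K₁ P) :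
    ∃ η, 0 < η ∧ (∀ x ∈ K₁, ∀ p ∈ P, η < dist x p) ∧ ∃ G : E → E, ContDiff ℝ ∞ G ∧
      EqIdOutsideBounded G ∧ G ⁻¹' P ⊆ K₂ᶜ ∧ ∀ T, IsCompact T → Disjoint K₂ T →
      ∃ δ, 0 < δ ∧ ∃ F : E → E, ContDiff ℝ ∞ F ∧ EqIdOutsideBounded F ∧
        (∀ x ∈ K₁, F x ∉ cthickening (2 * δ) T) ∧ ∀ x ∈ K₁, dist (G (F x)) x < η := by
  obtain ⟨η, hη, hdisj⟩ := hPK.exists_cthickenings h₁ hP.isClosed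
  have hη' : ∀ x ∈ K₁, ∀ p ∈ P, η < dist x p := fun x hx p hp => by
    by_contra! h
    exact hdisj.le_bot ⟨self_subset_cthickening _ hx, mem_cthickening_of_dist_le x p η P hp h⟩
  obtain ⟨G, hG, hGid, hGe⟩ := exists_contDiff_eqIdOutsideBounded_dist_lt h₂
    (g := fun y => (e.symm y : E)) (by fun_prop) (half_pos hη)
  refine ⟨η, hη, hη', G, hG, hGid, fun y hy hyK => ?_, fun T hT hTK => ?_⟩
  · have h := hη' _ (e.symm ⟨y, hyK⟩).2 _ hy
    rw [dist_comm] at h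
    linarith [hGe ⟨y, hyK⟩]
  obtain ⟨δ, hδ, hδT⟩ := hTK.exists_cthickenings h₂ hT.isClosed
  obtain ⟨δ', hδ', hδG⟩ := Metric.mem_uniformity_dist.1 (h₂.uniformContinuousAt_of_continuousAt G
    (fun y _ => hG.continuous.continuousAt) (dist_mem_uniformity (half_pos hη)))
  obtain ⟨F, hF, hFid, hFe⟩ := exists_contDiff_eqIdOutsideBounded_dist_lt h₁
    (g := fun x => (e x : E)) (by fun_prop) (lt_min hδ hδ')
  refine ⟨δ / 2, half_pos hδ, F, hF, hFid, fun x hx hxT => ?_, fun x hx => ?_⟩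
  · rw [mul_div_cancel₀ _ two_ne_zero] at hxT
    refine hδT.le_bot ⟨mem_cthickening_of_dist_le _ _ _ _ (e ⟨x, hx⟩).2 ?_, hxT⟩
    exact ((hFe ⟨x, hx⟩).trans_le (min_le_left _ _)).le
  · have h1 : dist (G (e ⟨x, hx⟩)) (G (F x)) < η / 2 :=
      hδG (by rw [dist_comm]; exact (hFe ⟨x, hx⟩).trans_le (min_le_right _ _)) (e ⟨x, hx⟩).2
    have h2 := hGe (e ⟨x, hx⟩)
    rw [e.symm_apply_apply] at h2
    have h3 := dist_triangle_left (G (F x)) x (G (e ⟨x, hx⟩))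
    dsimp only at h2
    linarith

/-- If the components of the support of `θ` can be joined inside of the complement of `K` and away
from the image of the boundary of `U`, then the degree integral of `θ` only depends on the integrals
of `θ` over the components of the complement of `K`. -/
theorem degreeIntegral_eq_sum [MeasurableSpace E] [BorelSpace E] {μ : Measure E}
    [μ.IsAddHaarMeasure] {K : Set E} (hK : IsClosed K) [Fintype (ConnectedComponents ↥Kᶜ)]
    {T : ConnectedComponents ↥Kᶜ → Set E} {y : ConnectedComponents ↥Kᶜ → E}
    (hT : ∀ j, IsPreconnected (T j)) (hy : ∀ j, y j ∈ T j) {U N : Set E} {F : E → E}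
    {ρ θ : E → ℝ} {δ : ℝ} (hδ : 0 < δ) (hρ : ContDiff ℝ ∞ ρ) (hρδ : ∀ z, δ < ‖z‖ → ρ z = 0)
    (hρ1 : ∫ z, ρ z ∂μ = 1) (hF : ContDiff ℝ ∞ F) (hU : IsOpen U) (hQ : IsCompact (U \ N))
    (hNT : ∀ j, ∀ x ∈ N, ∀ y ∈ T j, 2 * δ < dist (F x) y) (hθ : ContDiff ℝ ∞ θ)
    (hθc : HasCompactSupport θ) (hθK : ∀ x ∈ K, θ x = 0)
    (hθT : ∀ j, ∀ x ∈ complComponent K j, θ x ≠ 0 → x ∈ T j) :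
    degreeIntegral μ U F θ = ∑ j, (∫ x in complComponent K j, θ x ∂μ) *
      degreeIntegral μ U F (fun w => ρ (w - y j)) := by
  have hpt : ∀ j, ∀ x ∈ complComponent K j, θ x * degreeIntegral μ U F (fun w => ρ (w - x)) =
      θ x * degreeIntegral μ U F (fun w => ρ (w - y j)) := by
    intro j x hx
    by_cases h : θ x = 0
    · rw [h, zero_mul, zero_mul]
    · rw [degreeIntegral_translate_eq hδ hρ hρδ hF hU hQ (hT j) (hNT j) (hθT j x hx h) (hy j)]
  have hInt : Integrable θ μ := hθ.continuous.integrable_of_hasCompactSupport hθc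
  rw [degreeIntegral_eq_integral_mul hθ hθc hρ hρδ hρ1 hF hU hQ]
  · have hsum : ∀ x, θ x * degreeIntegral μ U F (fun w => ρ (w - x)) =
        ∑ j, (complComponent K j).indicator
          (fun x => θ x * degreeIntegral μ U F (fun w => ρ (w - y j))) x := by
      intro x
      by_cases hx : x ∈ K
      · rw [hθK x hx, zero_mul]
        refine (Finset.sum_eq_zero fun j _ => indicator_of_notMem ?_ _).symm
        exact fun h => complComponent_subset j h hx
      · obtain ⟨c, hc⟩ := exists_mem_complComponent hx
        rw [Finset.sum_eq_single c, indicator_of_mem hc, hpt c x hc]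
        · exact fun j _ hj => indicator_of_notMem
            (fun h => (pairwise_disjoint_complComponent hj).le_bot ⟨h, hc⟩) _
        · simp
    simp only [hsum]
    rw [integral_finsetSum]
    · refine Finset.sum_congr rfl fun j _ => ?_
      rw [integral_indicator (isOpen_complComponent hK j).measurableSet, integral_mul_const]
    · exact fun j _ => (hInt.mul_const _).indicator (isOpen_complComponent hK j).measurableSet
  · intro x hx z hz
    by_contra h
    have hxK : F x - z ∈ Kᶜ := fun h' => h (hθK _ h')
    obtain ⟨j, hj⟩ := exists_mem_complComponent hxK
    have h1 := hNT j x hx _ (hθT j _ hj h)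
    rw [dist_eq_norm, sub_sub_cancel] at h1
    linarith

theorem card_le_card_connectedComponents_compl {K₁ K₂ : Set E} (h₁ : IsCompact K₁)
    (h₂ : IsCompact K₂) (e : K₁ ≃ₜ K₂) [Fintype (ConnectedComponents ↥K₂ᶜ)] {ι : Type*} [Fintype ι]
    {c : ι → ConnectedComponents ↥K₁ᶜ} (hc : Injective c) :
    Fintype.card ι ≤ Fintype.card (ConnectedComponents ↥K₂ᶜ) := by
  classical
  let _ : MeasurableSpace E := borel E
  have : BorelSpace E := ⟨rfl⟩
  let μ : Measure E := Measure.addHaar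
  have hψ : ∀ i, ∃ ψ : E → ℝ, ContDiff ℝ ∞ ψ ∧ HasCompactSupport ψ ∧
      tsupport ψ ⊆ complComponent K₁ (c i) ∧ ∫ y, ψ y ∂μ = 1 := fun i =>
    have ⟨_, hx⟩ := (isConnected_complComponent (c i)).nonempty
    exists_contDiff_bump_integral_eq_one μ
      ((isOpen_complComponent h₁.isClosed (c i)).mem_nhds hx)
  choose ψ hψ hψc hψs hψ1 using hψ
  have hne : ∀ i, (tsupport (ψ i)).Nonempty := fun i => by
    by_contra h
    have h0 := hψ1 i
    rw [tsupport_eq_empty_iff.1 (not_nonempty_iff_eq_empty.1 h)] at h0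
    simp at h0
  obtain ⟨η, -, hηP, G, hG, hGid, hGP, H⟩ := e.exists_contDiff_approx h₁ h₂
    (P := ⋃ i, tsupport (ψ i)) (isCompact_iUnion fun i => hψc i)
    (disjoint_iUnion_right.2 fun i => disjoint_left.2 fun x hx hxs =>
      complComponent_subset _ (hψs i hxs) hx)
  have hS := hGid.isCompact_preimage hG.continuous (isCompact_iUnion fun i => hψc i)
  choose T hTc hTconn hST hTD using
    exists_isCompact_isConnected_complComponent h₂.isClosed hS hGP
  choose y hy using fun j => (hTconn j).nonempty
  obtain ⟨δ, hδ, F, hF, hFid, hFT, hGF⟩ := H (⋃ j, T j) (isCompact_iUnion hTc)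
    (disjoint_iUnion_right.2 fun j => disjoint_left.2 fun x hx hxT =>
      complComponent_subset _ (hTD j hxT) hx)
  obtain ⟨ρ, hρ, -, hρs, hρ1⟩ := exists_contDiff_bump_integral_eq_one μ (ball_mem_nhds (0 : E) hδ)
  have hρδ : ∀ z, δ < ‖z‖ → ρ z = 0 := fun z hz =>
    image_eq_zero_of_notMem_tsupport fun h => by
      have := hρs h
      rw [mem_ball_zero_iff] at this
      exact this.not_gt hz
  let θ : ι → E → ℝ := fun i y => ψ i (G y) * (fderiv ℝ G y).det
  have hθ0 : ∀ i y, θ i y ≠ 0 → y ∈ G ⁻¹' ⋃ i, tsupport (ψ i) := fun i y h =>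
    mem_iUnion.2 ⟨i, subset_tsupport _ (left_ne_zero_of_mul h)⟩
  let A : Matrix ι (ConnectedComponents ↥K₂ᶜ) ℝ := .of fun i j =>
    ∫ x in complComponent K₂ j, θ i x ∂μ
  let B : Matrix (ConnectedComponents ↥K₂ᶜ) ι ℝ := .of fun j k =>
    degreeIntegral μ (complComponent K₁ (c k)) F fun w => ρ (w - y j)
  have hAB : 1 = A * B := by
    ext i k
    have hN : IsOpen (F ⁻¹' cthickening (2 * δ) (⋃ j, T j))ᶜ :=
      (isClosed_cthickening.preimage hF.continuous).isOpen_compl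
    have hQ := isCompact_complComponent_diff h₁.isClosed (c k) hN hFT (by
      rw [compl_compl]
      exact hFid.isBounded_preimage (isCompact_iUnion hTc).isBounded.cthickening)
    have hsum := degreeIntegral_eq_sum (μ := μ) h₂.isClosed (fun j => (hTconn j).isPreconnected) hy
      hδ hρ hρδ hρ1 hF (isOpen_complComponent h₁.isClosed (c k)) hQ
      (fun j x hx z hz => by
        by_contra! h
        exact hx (mem_cthickening_of_dist_le _ _ _ _ (mem_iUnion.2 ⟨j, hz⟩) h))
      (((hψ i).comp hG).mul (contDiff_det_fderiv hG))
      (HasCompactSupport.intro hS fun z hz => by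
        by_contra h
        exact hz (hθ0 i z h))
      (fun z hz => by
        by_contra h
        exact hGP (hθ0 i z h) hz)
      (fun j z hz h => hST j ⟨hθ0 i z h, hz⟩)
    have hcomp := degreeIntegral_comp (μ := μ) (U := complComponent K₁ (c k)) (φ := ψ i) hG hF
    have hid := degreeIntegral_eq_setIntegral_of_dist_lt (μ := μ) h₁.isClosed (c k) (hG.comp hF)
      (hGid.comp hFid) (hψ i) (hψc i) (hne i) fun x hx => (hGF x hx).trans_le
        ((le_infDist (hne i)).2 fun {p} hp => (hηP x hx p (mem_iUnion.2 ⟨i, hp⟩)).le)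
    rw [setIntegral_complComponent_of_tsupport_subset (hψs i) (hψ1 i), hcomp] at hid
    rw [Matrix.one_apply, Matrix.mul_apply]
    simp only [hc.eq_iff] at hid
    rw [← hid]
    exact hsum
  calc Fintype.card ι = (1 : Matrix ι ι ℝ).rank := Matrix.rank_one.symm
    _ = (A * B).rank := by rw [← hAB]
    _ ≤ A.rank := Matrix.rank_mul_le_left A B
    _ ≤ Fintype.card (ConnectedComponents ↥K₂ᶜ) := A.rank_le_card_width

theorem finite_connectedComponents_compl {K₁ K₂ : Set E} (h₁ : IsCompact K₁)
    (h₂ : IsCompact K₂) (e : K₁ ≃ₜ K₂) [Finite (ConnectedComponents ↥K₂ᶜ)] :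
    Finite (ConnectedComponents ↥K₁ᶜ) := by
  have := Fintype.ofFinite (ConnectedComponents ↥K₂ᶜ)
  by_contra h
  rw [not_finite_iff_infinite] at h
  have := card_le_card_connectedComponents_compl h₁ h₂ e
    (c := fun i : Fin (Fintype.card (ConnectedComponents ↥K₂ᶜ) + 1) => Infinite.natEmbedding _ i)
    ((Infinite.natEmbedding _).injective.comp Fin.val_injective)
  simp at this

theorem nonempty_equiv_connectedComponents_compl {K₁ K₂ : Set E} (h₁ : IsCompact K₁)
    (h₂ : IsCompact K₂) (e : K₁ ≃ₜ K₂) :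
    Nonempty (ConnectedComponents ↥K₁ᶜ ≃ ConnectedComponents ↥K₂ᶜ) := by
  cases finite_or_infinite (ConnectedComponents ↥K₂ᶜ) with
  | inl hfin =>
    have := finite_connectedComponents_compl h₁ h₂ e
    have := Fintype.ofFinite (ConnectedComponents ↥K₁ᶜ)
    have := Fintype.ofFinite (ConnectedComponents ↥K₂ᶜ)
    exact Fintype.card_eq.1 ((card_le_card_connectedComponents_compl h₁ h₂ e injective_id).antisymm
      (card_le_card_connectedComponents_compl h₂ h₁ e.symm injective_id))
  | inr hinf =>
    have : Infinite (ConnectedComponents ↥K₁ᶜ) := by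
      by_contra h
      rw [not_infinite_iff_finite] at h
      have := finite_connectedComponents_compl h₂ h₁ e.symm
      exact not_finite (ConnectedComponents ↥K₂ᶜ)
    have := countable_connectedComponents_compl h₁.isClosed
    have := countable_connectedComponents_compl h₂.isClosed
    exact nonempty_equiv_of_countable

end Comparison

/-- version of the Jordan–Brouwer separation theorem: if `K₁` and `K₂` are
homeomorphic compact subsets of `ℝ^d`, then `ℝ^d \ K₁` and `ℝ^d \ K₂` have the same number
of connected components. -/
theorem stmt8 (d : ℕ) (hd : 1 ≤ d)
    (K₁ K₂ : Set (EuclideanSpace ℝ (Fin d)))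
    (h₁ : IsCompact K₁) (h₂ : IsCompact K₂)
    (hhomeo : Nonempty (↥K₁ ≃ₜ ↥K₂)) :
    Nonempty (ConnectedComponents ↥(K₁ᶜ) ≃ ConnectedComponents ↥(K₂ᶜ)) := by
  obtain ⟨e⟩ := hhomeo
  exact nonempty_equiv_connectedComponents_compl h₁ h₂ e
end

section
/- Let d ≥ 2 and let ψ : ℝ^d → ℝ^d be continuous and injective. Then for every n ∈ ℕ with n ≥ 1, both ℝ^d \ ψ(B[0,n]) and ℝ^d \ ψ(B(0,n)) are connected subsets of ℝ^d. -/
open Metric Set MeasureTheory Module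
open scoped NNReal

section NoRetraction

theorem Polynomial.eval_eq_sum_lagrange_basis (p : Polynomial ℝ) {m : ℕ} (hp : p.natDegree ≤ m)
    {t : ℕ → ℝ} (ht : Function.Injective t) (x : ℝ) :
    p.eval x = ∑ i ∈ Finset.range (m + 1),
      p.eval (t i) * (Lagrange.basis (Finset.range (m + 1)) t i).eval x := by
  have hdeg : p.degree < (Finset.range (m + 1)).card := by
    rw [Finset.card_range]
    exact p.degree_le_natDegree.trans_lt (by exact_mod_cast Nat.lt_succ_of_le hp)
  conv_lhs => rw [Lagrange.eq_interpolate (ht.injOn) hdeg]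
  simp [Lagrange.interpolate_apply, Polynomial.eval_finsetSum]

theorem LinearMap.exists_polynomial_det_one_add_smul {E : Type*} [AddCommGroup E] [Module ℝ E]
    [FiniteDimensional ℝ E] (A : E →ₗ[ℝ] E) :
    ∃ p : Polynomial ℝ, p.natDegree ≤ finrank ℝ E ∧
      ∀ t : ℝ, p.eval t = LinearMap.det (1 + t • A) := by
  classical
  let b := finBasis ℝ E
  let M := LinearMap.toMatrix b b A
  refine ⟨Matrix.det ((Polynomial.X : Polynomial ℝ) • M.map Polynomial.C +
    (1 : Matrix _ _ ℝ).map Polynomial.C), ?_, fun t => ?_⟩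
  · simpa using Polynomial.natDegree_det_X_add_C_le M 1
  · rw [← LinearMap.det_toMatrix b, ← Polynomial.coe_evalRingHom, RingHom.map_det]
    congr 1
    ext i j
    by_cases h : i = j <;> simp [M, h] <;> ring

variable {E : Type*} [NormedAddCommGroup E] [NormedSpace ℝ E]

theorem LipschitzOnWith.lipschitzWith_indicator_ball {v : E → E} {K : ℝ≥0} {R : ℝ}
    (hv : LipschitzOnWith K v (closedBall 0 R)) (h0 : ∀ x ∈ sphere (0 : E) R, v x = 0) :
    LipschitzWith K ((ball (0 : E) R).indicator v) := by
  have key : ∀ x ∈ ball (0 : E) R, ∀ y ∉ ball (0 : E) R, dist (v x) 0 ≤ K * dist x y := by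
    intro x hx y hy
    obtain ⟨z, hz, hzR⟩ := (convex_segment x y).isPreconnected.intermediate_value
      (left_mem_segment ℝ x y) (right_mem_segment ℝ x y) continuous_norm.continuousOn
      (show R ∈ Icc ‖x‖ ‖y‖ by simp at hx hy; exact ⟨hx.le, hy⟩)
    have hzs : z ∈ sphere (0 : E) R := by simpa using hzR
    rw [← h0 z hzs]
    refine (hv.dist_le_mul x (ball_subset_closedBall hx) z (sphere_subset_closedBall hzs)).trans ?_
    gcongr
    have := dist_add_dist_of_mem_segment hz
    linarith [dist_nonneg (x := z) (y := y)]
  refine LipschitzWith.of_dist_le_mul fun x y => ?_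
  by_cases hx : x ∈ ball (0 : E) R <;> by_cases hy : y ∈ ball (0 : E) R
  · simpa only [indicator_of_mem hx, indicator_of_mem hy] using
      hv.dist_le_mul x (ball_subset_closedBall hx) y (ball_subset_closedBall hy)
  · simpa only [indicator_of_mem hx, indicator_of_notMem hy] using key x hx y hy
  · simpa only [indicator_of_notMem hx, indicator_of_mem hy, dist_comm] using key y hy x hx
  · simp only [indicator_of_notMem hx, indicator_of_notMem hy, dist_self]
    positivity

theorem LipschitzWith.bijective_add_smul [CompleteSpace E] {w : E → E} {K : ℝ≥0}
    (hw : LipschitzWith K w) {t : ℝ≥0} (ht : t * K < 1) :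
    Function.Bijective fun x => x + (t : ℝ) • w x := by
  rcases subsingleton_or_nontrivial E with hE | hE
  · exact ⟨Function.injective_of_subsingleton _, Function.surjective_to_subsingleton _⟩
  have happ : ApproximatesLinearOn (fun x => x + (t : ℝ) • w x)
      ((ContinuousLinearEquiv.refl ℝ E : E ≃L[ℝ] E) : E →L[ℝ] E) univ (t * K) := by
    intro x _ y _
    have h := hw.dist_le_mul x y
    rw [dist_eq_norm, dist_eq_norm] at h
    have h1 : x + (t : ℝ) • w x - (y + (t : ℝ) • w y) - (x - y) = (t : ℝ) • (w x - w y) := by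
      rw [smul_sub]; abel
    simp only [ContinuousLinearEquiv.coe_refl, ContinuousLinearMap.coe_id', id_eq, h1, norm_smul,
      Real.norm_eq_abs, NNReal.abs_eq, NNReal.coe_mul, mul_assoc]
    gcongr
  have hc : Subsingleton E ∨ t * K < ‖((ContinuousLinearEquiv.refl ℝ E : E ≃L[ℝ] E).symm :
      E →L[ℝ] E)‖₊⁻¹ := by
    right
    have : ‖((ContinuousLinearEquiv.refl ℝ E : E ≃L[ℝ] E).symm : E →L[ℝ] E)‖₊ = 1 := by
      ext; simp
    rw [this]; simpa using ht
  exact ⟨injOn_univ.1 (happ.injOn hc), happ.surjective hc⟩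

variable [FiniteDimensional ℝ E] [MeasurableSpace E] [BorelSpace E]
  (μ : Measure E) [μ.IsAddHaarMeasure]

theorem exists_forall_integral_det_one_add_smul_fderiv {v : E → E} (hv : ContDiff ℝ 1 v)
    {R : ℝ} (h0 : ∀ x ∈ sphere (0 : E) R, v x = 0) :
    ∃ ε > 0, ∀ t : ℝ≥0, (t : ℝ) < ε →
      ∫ x in ball 0 R, (1 + (t : ℝ) • fderiv ℝ v x).det ∂μ = μ.real (ball 0 R) := by
  have hfc : Continuous (fderiv ℝ v) := hv.continuous_fderiv one_ne_zero
  obtain ⟨C, hC⟩ := (isCompact_closedBall (0 : E) R).exists_bound_of_continuousOn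
    hfc.continuousOn
  set K : ℝ≥0 := C.toNNReal + 1
  have hK : ∀ x ∈ closedBall (0 : E) R, ‖fderiv ℝ v x‖ ≤ K := fun x hx =>
    (hC x hx).trans ((Real.le_coe_toNNReal C).trans (by simp [K]))
  have hKpos : (0 : ℝ) < K := by simp only [K]; positivity
  have hlip : LipschitzOnWith K v (closedBall 0 R) :=
    (convex_closedBall 0 R).lipschitzOnWith_of_nnnorm_fderiv_le
      (fun x _ => (hv.differentiable one_ne_zero) x) hK
  have hw := hlip.lipschitzWith_indicator_ball h0
  have hdet : ∀ᶠ A : E →L[ℝ] E in nhds 0, 0 < (1 + A).det := by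
    have : Continuous fun A : E →L[ℝ] E => (1 + A).det :=
      ContinuousLinearMap.continuous_det.comp (by fun_prop)
    refine this.continuousAt.eventually_const_lt ?_
    simp [ContinuousLinearMap.det]
  obtain ⟨η, hη, hdet⟩ := Metric.eventually_nhds_iff.1 hdet
  refine ⟨min (1 / K) (η / K), by positivity, fun t ht => ?_⟩
  have ht1 : (t : ℝ) * K < 1 := (lt_div_iff₀ hKpos).1 (ht.trans_le (min_le_left _ _))
  have ht2 : (t : ℝ) * K < η := (lt_div_iff₀ hKpos).1 (ht.trans_le (min_le_right _ _))
  set w := (ball (0 : E) R).indicator v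
  have hbij := hw.bijective_add_smul (t := t) (by exact_mod_cast ht1)
  set f : E → E := fun x => x + (t : ℝ) • w x
  have hfout : ∀ x ∉ ball (0 : E) R, f x = x := fun x hx => by
    simp [f, w, indicator_of_notMem hx]
  have himg : f '' ball 0 R = ball 0 R := by
    rw [← compl_inj_iff, ← image_compl_eq hbij]
    exact (image_congr fun x hx => hfout x hx).trans (image_id' _)
  have hder : ∀ x ∈ ball (0 : E) R,
      HasFDerivWithinAt f (1 + (t : ℝ) • fderiv ℝ v x) (ball 0 R) x := by
    intro x hx
    have h := ((hasFDerivAt_id (𝕜 := ℝ) x).add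
      (((hv.differentiable one_ne_zero) x).hasFDerivAt.const_smul (t : ℝ))).hasFDerivWithinAt
        (s := ball 0 R)
    refine h.congr (fun y hy => ?_) ?_
    · simp [f, w, indicator_of_mem hy]
    · simp [f, w, indicator_of_mem hx]
  have := integral_image_eq_integral_abs_det_fderiv_smul μ measurableSet_ball hder
    (hbij.1.injOn) (fun _ => (1 : ℝ))
  rw [himg] at this
  simp only [integral_const, smul_eq_mul, mul_one, measureReal_restrict_apply_univ] at this
  rw [this]
  refine setIntegral_congr_fun measurableSet_ball fun x hx => ?_
  rw [abs_of_pos]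
  apply hdet
  rw [dist_zero_right, norm_smul, Real.norm_eq_abs, NNReal.abs_eq]
  exact (mul_le_mul_of_nonneg_left (hK x (ball_subset_closedBall hx)) t.2).trans_lt ht2

theorem integral_det_one_add_fderiv {v : E → E} (hv : ContDiff ℝ 1 v)
    {R : ℝ} (h0 : ∀ x ∈ sphere (0 : E) R, v x = 0) :
    ∫ x in ball 0 R, (1 + fderiv ℝ v x).det ∂μ = μ.real (ball 0 R) := by
  obtain ⟨ε, hε, h⟩ := exists_forall_integral_det_one_add_smul_fderiv μ hv h0
  set m := finrank ℝ E
  set t : ℕ → ℝ := fun i => ε / (i + 2)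
  have ht : Function.Injective t := fun i j hij => by
    simp only [t] at hij
    rw [div_eq_div_iff (by positivity) (by positivity)] at hij
    have := mul_left_cancel₀ hε.ne' hij
    exact_mod_cast (add_right_cancel this).symm
  set c : ℕ → ℝ := fun i => (Lagrange.basis (Finset.range (m + 1)) t i).eval 1
  have hc : ∑ i ∈ Finset.range (m + 1), c i = 1 := by
    have := Polynomial.eval_eq_sum_lagrange_basis 1 (m := m) (by simp) ht 1
    simpa using this.symm
  have hexp : ∀ x, (1 + fderiv ℝ v x).det =
      ∑ i ∈ Finset.range (m + 1), (1 + t i • fderiv ℝ v x).det * c i := by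
    intro x
    obtain ⟨p, hp, hpe⟩ := LinearMap.exists_polynomial_det_one_add_smul
      (fderiv ℝ v x : E →ₗ[ℝ] E)
    have := p.eval_eq_sum_lagrange_basis hp ht 1
    simp only [hpe, one_smul] at this
    exact this
  have hint : ∀ s : ℝ, IntegrableOn (fun x => (1 + s • fderiv ℝ v x).det) (ball 0 R) μ := by
    intro s
    have hfc : Continuous (fderiv ℝ v) := hv.continuous_fderiv one_ne_zero
    have : Continuous fun x => (1 + s • fderiv ℝ v x).det :=
      ContinuousLinearMap.continuous_det.comp (by fun_prop)
    exact (this.continuousOn.integrableOn_compact (isCompact_closedBall 0 R)).mono_set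
      ball_subset_closedBall
  simp_rw [hexp]
  rw [integral_finsetSum _ fun i _ => (hint (t i)).mul_const _]
  have hti : ∀ i, ∫ x in ball 0 R, (1 + t i • fderiv ℝ v x).det ∂μ = μ.real (ball 0 R) := by
    intro i
    have hpos : 0 ≤ t i := by simp only [t]; positivity
    refine h ⟨t i, hpos⟩ (div_lt_self hε ?_)
    have : (0 : ℝ) ≤ i := i.cast_nonneg
    linarith
  simp_rw [integral_mul_const, hti, ← Finset.mul_sum, hc, mul_one]

end NoRetraction

theorem exists_eq_zero_of_eq_self_off_ball {E : Type*} [NormedAddCommGroup E]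
    [InnerProductSpace ℝ E] [FiniteDimensional ℝ E] {g : E → E} (hg : Continuous g) {R : ℝ}
    (hgR : ∀ x, R ≤ ‖x‖ → g x = x) : ∃ x, g x = 0 := by
  by_contra! hne
  borelize E
  obtain ⟨u, hu, hudist, husupp⟩ := (hg.sub continuous_id).exists_contDiff_approx 1 hg.norm
    (fun x => norm_pos_iff.2 (hne x))
  set h : E → E := fun x => x + u x
  have hh : ContDiff ℝ 1 h := contDiff_id.add hu
  have hh0 : ∀ x, h x ≠ 0 := fun x hx => by
    have := hudist x
    rw [dist_eq_norm] at this
    have e : u x - (g x - x) = h x - g x := by simp only [h]; abel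
    simp only [Pi.sub_apply, id, e, hx, zero_sub, norm_neg, lt_irrefl] at this
  set S := max R 1
  have hS : 0 < S := lt_max_of_lt_right one_pos
  have hhS : ∀ x, ‖x‖ = S → h x = x := fun x hx => by
    have : u x = 0 := by
      by_contra hux
      exact husupp hux (by simp [hgR x (hx ▸ le_max_left _ _)])
    simp [h, this]
  set G : E → E := fun x => (S * ‖h x‖⁻¹) • h x
  have hG : ContDiff ℝ 1 G :=
    (contDiff_const.mul ((hh.norm ℝ hh0).inv fun x => norm_ne_zero_iff.2 (hh0 x))).smul hh
  have hGn : ∀ x, ‖G x‖ = S := fun x => by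
    have := norm_ne_zero_iff.2 (hh0 x)
    simp only [G, norm_smul, norm_mul, norm_inv, norm_norm, Real.norm_of_nonneg hS.le]
    field_simp
  have key := integral_det_one_add_fderiv (volume : Measure E) (v := fun x => G x - x) (R := S)
    (hG.sub contDiff_id) (fun x hx => by
      have hx : ‖x‖ = S := by simpa using hx
      simp only [G, hhS x hx, hx, mul_inv_cancel₀ hS.ne', one_smul, sub_self])
  have hdet : ∀ x, (1 + fderiv ℝ (fun x => G x - x) x).det = 0 := by
    intro x
    have hGd := (hG.differentiable one_ne_zero) x
    have e : 1 + fderiv ℝ (fun x => G x - x) x = fderiv ℝ G x := by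
      rw [fderiv_fun_sub hGd differentiableAt_fun_id, fderiv_fun_id]
      exact add_sub_cancel _ _
    rw [e]
    by_contra hne0
    have hsurj : Function.Surjective (fderiv ℝ G x) := by
      have := (LinearMap.isUnit_iff_isUnit_det (fderiv ℝ G x : E →ₗ[ℝ] E)).2
        (isUnit_iff_ne_zero.2 hne0)
      exact ((Module.End.isUnit_iff _).1 this).2
    obtain ⟨y, hy⟩ := hsurj (G x)
    have h1 := (hGd.hasFDerivAt.norm_sq)
    have h2 : HasFDerivAt (fun x => ‖G x‖ ^ 2) (0 : E →L[ℝ] ℝ) x := by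
      simp_rw [hGn]; exact hasFDerivAt_const _ _
    have h3 := congrArg (fun L : E →L[ℝ] ℝ => L y) (h1.unique h2)
    simp [hy, hGn, hS.ne'] at h3
  simp only [hdet, integral_zero] at key
  have hpos : 0 < (volume : Measure E).real (ball 0 S) :=
    ENNReal.toReal_pos (measure_ball_pos _ _ hS).ne' measure_ball_lt_top.ne
  exact hpos.ne key

theorem isPreconnected_compl_closedBall {E : Type*} [NormedAddCommGroup E] [NormedSpace ℝ E]
    (hE : 1 < Module.rank ℝ E) {R : ℝ} (hR : 0 ≤ R) : IsPreconnected (closedBall (0 : E) R)ᶜ := by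
  have h := ((isPreconnected_sphere hE (0 : E) 1).prod (isPreconnected_Ioi (a := R))).image
    (fun q => q.2 • q.1) (by fun_prop)
  convert h using 1
  ext x
  simp only [mem_compl_iff, mem_closedBall, dist_zero_right, not_le, mem_image, mem_prod,
    mem_sphere, mem_Ioi, Prod.exists]
  constructor
  · intro hx
    have hx0 : ‖x‖ ≠ 0 := (hR.trans_lt hx).ne'
    refine ⟨‖x‖⁻¹ • x, ‖x‖, ⟨?_, hx⟩, ?_⟩
    · rw [norm_smul, norm_inv, norm_norm, inv_mul_cancel₀ hx0]
    · rw [smul_smul, mul_inv_cancel₀ hx0, one_smul]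
  · rintro ⟨y, s, ⟨hy, hs⟩, rfl⟩
    rwa [norm_smul, hy, mul_one, Real.norm_of_nonneg (hR.trans hs.le)]

theorem IsClosed.frontier_connectedComponentIn_compl_subset {X : Type*} [TopologicalSpace X]
    [LocallyConnectedSpace X] {K : Set X} (hK : IsClosed K) (p : X) :
    frontier (connectedComponentIn Kᶜ p) ⊆ K := by
  intro q hq
  by_contra hqK
  have hop : ∀ x, IsOpen (connectedComponentIn Kᶜ x) := fun x =>
    hK.isOpen_compl.connectedComponentIn
  rw [(hop p).frontier_eq] at hq
  obtain ⟨z, hzq, hzp⟩ := mem_closure_iff.1 hq.1 _ (hop q) (mem_connectedComponentIn hqK)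
  apply hq.2
  rw [connectedComponentIn_eq hzp, ← connectedComponentIn_eq hzq]
  exact mem_connectedComponentIn hqK

section Separation

variable {E : Type*} [NormedAddCommGroup E] [InnerProductSpace ℝ E] [FiniteDimensional ℝ E]

theorem IsCompact.not_isBounded_connectedComponentIn_compl {K : Set E} (hK : IsCompact K)
    {r : E → E} (hr : Continuous r) (hrK : ∀ x, r x ∈ K) (hr_id : ∀ x ∈ K, r x = x)
    {p : E} (hp : p ∉ K) : ¬ Bornology.IsBounded (connectedComponentIn Kᶜ p) := by
  classical
  intro hb
  obtain ⟨R, hR⟩ := hb.subset_closedBall p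
  set V := connectedComponentIn Kᶜ p
  have hpV : p ∈ V := mem_connectedComponentIn hp
  have hg : Continuous (V.piecewise r id) :=
    hr.piecewise (fun a ha =>
      hr_id a (hK.isClosed.frontier_connectedComponentIn_compl_subset p ha)) continuous_id
  obtain ⟨x, hx⟩ := exists_eq_zero_of_eq_self_off_ball
    (g := fun x => V.piecewise r id (x + p) - p) (by fun_prop) (R := R + 1) (fun x hx => by
      have : x + p ∉ V := fun h => by
        have := hR h
        rw [mem_closedBall, dist_eq_norm, add_sub_cancel_right] at this
        linarith
      simp [piecewise_eq_of_notMem _ _ _ this])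
  rw [sub_eq_zero] at hx
  by_cases h : x + p ∈ V
  · rw [piecewise_eq_of_mem _ _ _ h] at hx
    exact hp (hx ▸ hrK _)
  · rw [piecewise_eq_of_notMem _ _ _ h] at hx
    exact h (by rwa [show x + p = p from hx])

theorem IsCompact.isConnected_compl_of_retract (hE : 1 < Module.rank ℝ E) {K : Set E}
    (hK : IsCompact K) {r : E → E} (hr : Continuous r) (hrK : ∀ x, r x ∈ K)
    (hr_id : ∀ x ∈ K, r x = x) : IsConnected Kᶜ := by
  obtain ⟨R, hRpos, hR⟩ := hK.isBounded.subset_closedBall_lt 0 (0 : E)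
  have hsub : (closedBall (0 : E) R)ᶜ ⊆ Kᶜ := compl_subset_compl.2 hR
  have : Nontrivial E := rank_pos_iff_nontrivial.1 (zero_lt_one.trans hE)
  obtain ⟨x₀, hx₀⟩ := NormedSpace.exists_lt_norm ℝ E R
  have hx₀ : x₀ ∈ (closedBall (0 : E) R)ᶜ := by simpa using hx₀
  refine ⟨⟨x₀, hsub hx₀⟩, isPreconnected_of_forall x₀ fun y hy => ?_⟩
  have hV := hK.not_isBounded_connectedComponentIn_compl hr hrK hr_id hy
  obtain ⟨z, hzV, hz⟩ : ∃ z ∈ connectedComponentIn Kᶜ y, z ∉ closedBall (0 : E) R :=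
    not_subset.1 fun h => hV (isBounded_closedBall.subset h)
  exact ⟨connectedComponentIn Kᶜ y ∪ (closedBall (0 : E) R)ᶜ,
    union_subset (connectedComponentIn_subset _ _) hsub, Or.inr hx₀,
    Or.inl (mem_connectedComponentIn hy),
    isPreconnected_connectedComponentIn.union z hzV hz
      (isPreconnected_compl_closedBall hE hRpos.le)⟩

theorem isConnected_compl_image_closedBall (hE : 1 < Module.rank ℝ E) {ψ : E → E}
    (hc : Continuous ψ) (hinj : Function.Injective ψ) (x : E) {ρ : ℝ} (hρ : 0 < ρ) :
    IsConnected (ψ '' closedBall x ρ)ᶜ := by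
  have : TietzeExtension (closedBall x ρ) := instTietzeExtensionClosedBall ℝ x hρ
  have : CompactSpace (closedBall x ρ) := isCompact_iff_compactSpace.1 (isCompact_closedBall x ρ)
  have he : Topology.IsClosedEmbedding (fun y : closedBall x ρ => ψ y) :=
    (hc.comp continuous_subtype_val).isClosedEmbedding (hinj.comp Subtype.val_injective)
  obtain ⟨s, hs⟩ := ContinuousMap.exists_extension' he (ContinuousMap.id (closedBall x ρ))
  refine ((isCompact_closedBall x ρ).image hc).isConnected_compl_of_retract hE
    (r := fun y => ψ (s y)) (by fun_prop) (fun y => mem_image_of_mem ψ (s y).2) ?_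
  rintro _ ⟨y, hy, rfl⟩
  have := congrFun hs ⟨y, hy⟩
  simp only [Function.comp_apply, ContinuousMap.id_apply] at this
  rw [this]

theorem isConnected_compl_image_ball (hE : 1 < Module.rank ℝ E) {ψ : E → E}
    (hc : Continuous ψ) (hinj : Function.Injective ψ) (x : E) {ρ : ℝ} (hρ : 0 < ρ) :
    IsConnected (ψ '' ball x ρ)ᶜ := by
  have : Nontrivial E := rank_pos_iff_nontrivial.1 (zero_lt_one.trans hE)
  refine (isConnected_compl_image_closedBall hE hc hinj x hρ).subset_closure
    (compl_subset_compl.2 (image_mono ball_subset_closedBall)) fun y hy => ?_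
  by_cases h : y ∈ ψ '' closedBall x ρ
  · obtain ⟨z, -, rfl⟩ := h
    have hz : z ∈ closure (closedBall x ρ)ᶜ := by
      rw [closure_compl, interior_closedBall x hρ.ne']
      exact fun hz => hy (mem_image_of_mem ψ hz)
    refine closure_mono ?_ (image_closure_subset_closure_image hc (mem_image_of_mem ψ hz))
    exact image_compl_subset hinj
  · exact subset_closure h

end Separation

/-- for `d ≥ 2` and `ψ : ℝ^d → ℝ^d` continuous and injective, for every `n ≥ 1`
both `ℝ^d \ ψ(B[0,n])` and `ℝ^d \ ψ(B(0,n))` are connected. -/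
theorem stmt10 (d : ℕ) (hd : 2 ≤ d)
    (ψ : EuclideanSpace ℝ (Fin d) → EuclideanSpace ℝ (Fin d))
    (hc : Continuous ψ) (hinj : Function.Injective ψ)
    (n : ℕ) (hn : 1 ≤ n) :
    IsConnected ((ψ '' Metric.closedBall 0 (n : ℝ))ᶜ) ∧
    IsConnected ((ψ '' Metric.ball 0 (n : ℝ))ᶜ) := by
  have hE : 1 < Module.rank ℝ (EuclideanSpace ℝ (Fin d)) := by
    rw [← Module.finrank_eq_rank, finrank_euclideanSpace_fin]
    exact_mod_cast hd
  have hn' : (0 : ℝ) < n := by exact_mod_cast hn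
  exact ⟨isConnected_compl_image_closedBall hE hc hinj 0 hn',
    isConnected_compl_image_ball hE hc hinj 0 hn'⟩
end
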